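/- arXiv:2408.13436 — 3 statements merged into one kernel-verified Lean document; each statement's English description precedes it below -/
import Mathlib

section
/- Let G be a finite group, N a normal subgroup, and θ an irreducible complex character of N that is G-invariant. If χ is an irreducible character of G lying over θ and x ∈ G, then θ(1)·|G : C_G(Nx)|·χ(x)/χ(1) is an algebraic integer, where C_G(Nx) = {g ∈ G | [g,x] ∈ N} is the full preimage in G of the centralizer of Nx in G/N. -/
open scoped BigOperators
noncomputable section

open Classical in
/-- The `π`-part of a natural number: the product of prime powers in its
factorization whose primes lie in `π`. -/
def Nat.piPart (π : Set ℕ) (n : ℕ) : ℕ :=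
  n.factorization.prod fun p k => if p ∈ π then p ^ k else 1

/-- `n` is a `π`-number if every prime dividing `n` lies in `π`. -/
def IsPiNumber (π : Set ℕ) (n : ℕ) : Prop :=
  ∀ p : ℕ, p.Prime → p ∣ n → p ∈ π

/-- The `π`-part of an element of a finite group: the unique power of `g`
whose order is a `π`-number and whose complementary part has `π'`-order. -/
def elemPiPart (π : Set ℕ) {G : Type} [Group G] (g : G) : G :=
  g ^ ((orderOf g / Nat.piPart π (orderOf g)) ^ Nat.totient (Nat.piPart π (orderOf g)))

/-- `χ` is the character of some finite-dimensional complex representation of `G`. -/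
def IsChar (G : Type) [Group G] (χ : G → ℂ) : Prop :=
  ∃ V : FDRep ℂ G, ∀ g : G, χ g = V.character g

/-- The usual inner product of complex class functions. -/
def charInner (G : Type) [Group G] (φ ψ : G → ℂ) : ℂ :=
  (Nat.card G : ℂ)⁻¹ * ∑ᶠ g : G, φ g * starRingEnd ℂ (ψ g)

/-- An irreducible character: a character of norm one. -/
def IsIrrChar (G : Type) [Group G] (χ : G → ℂ) : Prop :=
  IsChar G χ ∧ charInner G χ χ = 1

/-- A class function. -/
def IsClassFun (G : Type) [Group G] (φ : G → ℂ) : Prop :=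
  ∀ g h : G, φ (h * g * h⁻¹) = φ g

/-- A virtual (generalized) character: a difference of two characters. -/
def IsGenChar (G : Type) [Group G] (ψ : G → ℂ) : Prop :=
  ∃ α β : G → ℂ, IsChar G α ∧ IsChar G β ∧ ψ = α - β

/-- `θ`, a character of the normal subgroup `N` of `G`, is `G`-invariant. -/
def IsGInvariant {G : Type} [Group G] (N : Subgroup G) [hN : N.Normal]
    (θ : ↥N → ℂ) : Prop :=
  ∀ (g : G) (n : ↥N), θ ⟨g * (n : G) * g⁻¹, hN.conj_mem (n : G) n.2 g⟩ = θ n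

/-- π-defect zero irreducible characters of a group `Q`. -/
def dzSet (π : Set ℕ) (Q : Type) [Group Q] : Set (Q → ℂ) :=
  {χ | IsIrrChar Q χ ∧ ∃ d : ℕ, χ 1 = (d : ℂ) ∧
    Nat.piPart π d = Nat.piPart π (Nat.card Q)}

/-- Irreducible characters of `G` lying over `θ ∈ Irr N` of relative π-defect zero. -/
def rdzSet (π : Set ℕ) (G : Type) [Group G] (N : Subgroup G) (θ : ↥N → ℂ) :
    Set (G → ℂ) :=
  {χ | IsIrrChar G χ ∧ charInner ↥N (fun n : ↥N => χ (n : G)) θ ≠ 0 ∧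
    ∃ m : ℕ, χ 1 = θ 1 * (m : ℂ) ∧ Nat.piPart π m = Nat.piPart π N.index}

section MatrixRepresentations

variable {H : Type} [Group H] {ι : Type} [Fintype ι] [DecidableEq ι]

/-- Every matrix commuting with the matrix representation `σ` is a scalar. -/
def HasScalarCommutant (σ : H →* Matrix ι ι ℂ) : Prop :=
  ∀ X : Matrix ι ι ℂ, (∀ h, X * σ h = σ h * X) → ∃ c : ℂ, X = c • 1

lemma map_inv_mul_map (σ : H →* Matrix ι ι ℂ) (h : H) : σ h⁻¹ * σ h = 1 := by
  rw [← map_mul, inv_mul_cancel, map_one]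

lemma map_mul_map_inv (σ : H →* Matrix ι ι ℂ) (h : H) : σ h * σ h⁻¹ = 1 := by
  rw [← map_mul, mul_inv_cancel, map_one]

open scoped ComplexOrder in
lemma trace_map_inv [Fintype H] (σ : H →* Matrix ι ι ℂ) (h : H) :
    (σ h⁻¹).trace = starRingEnd ℂ (σ h).trace := by
  classical
  set P : Matrix ι ι ℂ := ∑ k, (σ k).conjTranspose * σ k with hP
  have hpos : P.PosDef := by
    rw [hP, ← Finset.add_sum_erase _ _ (Finset.mem_univ (1 : H))]
    refine Matrix.PosDef.add_posSemidef (by simpa using Matrix.PosDef.one)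
      (Matrix.posSemidef_sum _ fun k _ => Matrix.posSemidef_conjTranspose_mul_self _)
  have hinv : (σ h).conjTranspose * P * σ h = P := by
    rw [hP, Finset.mul_sum, Finset.sum_mul, ← Equiv.sum_comp (Equiv.mulRight h)
      (fun k => (σ k).conjTranspose * σ k)]
    simp [Matrix.conjTranspose_mul, Matrix.mul_assoc]
  have h1 : (σ h).conjTranspose * P = P * σ h⁻¹ := by
    calc _ = (σ h).conjTranspose * P * (σ h * σ h⁻¹) := by rw [map_mul_map_inv, mul_one]
      _ = P * σ h⁻¹ := by rw [← mul_assoc, hinv]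
  obtain ⟨u, hu⟩ := hpos.isUnit
  have h2 : σ h⁻¹ = (↑u⁻¹ : Matrix ι ι ℂ) * ((σ h).conjTranspose * u) := by
    rw [hu, h1, ← hu, ← mul_assoc, Units.inv_mul, one_mul]
  rw [h2, Matrix.trace_mul_comm, mul_assoc, Units.mul_inv, mul_one,
    Matrix.trace_conjTranspose, starRingEnd_apply]

lemma charInner_trace {κ : Type} [Fintype κ] [DecidableEq κ] [Fintype H]
    (ρ : H →* Matrix κ κ ℂ) (σ : H →* Matrix ι ι ℂ) :
    charInner H (fun h => (ρ h).trace) (fun h => (σ h).trace) =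
      (Fintype.card H : ℂ)⁻¹ * ∑ h, (ρ h).trace * (σ h⁻¹).trace := by
  simp only [charInner, finsum_eq_sum_of_fintype, Nat.card_eq_fintype_card, trace_map_inv]

lemma exists_matrix_representation [Fintype H] {χ : H → ℂ} (hχ : IsIrrChar H χ) :
    ∃ (d : ℕ) (σ : H →* Matrix (Fin d) (Fin d) ℂ),
      χ = (fun h => (σ h).trace) ∧ HasScalarCommutant σ := by
  obtain ⟨⟨V, hV⟩, hnorm⟩ := hχ
  let b := Module.finBasis ℂ V
  let Φ := LinearMap.toMatrixAlgEquiv b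
  let σ : H →* Matrix _ _ ℂ := (MonoidHomClass.toMonoidHom Φ).comp V.ρ
  have hσ : χ = fun h => (σ h).trace := by
    funext h
    rw [hV]
    exact LinearMap.trace_eq_matrix_trace ℂ b _
  refine ⟨_, σ, hσ, fun X hX => ?_⟩
  have : Invertible (Nat.card H : ℂ) := invertibleOfNonzero (by simp)
  have hchar : ∀ h, (σ h).trace = Representation.character V.ρ h := fun h =>
    (LinearMap.trace_eq_matrix_trace ℂ b _).symm
  have hrank : Module.finrank ℂ (Representation.IntertwiningMap V.ρ V.ρ) = 1 := by
    have h1 := Representation.card_inv_mul_sum_char_mul_char_eq_finrank V.ρ V.ρ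
    rw [hσ, charInner_trace] at hnorm
    simp only [hchar, ← Nat.card_eq_fintype_card] at hnorm
    rw [hnorm] at h1
    exact_mod_cast h1.symm
  let T : Representation.IntertwiningMap V.ρ V.ρ :=
    ⟨Φ.symm X, fun h => by
      apply Φ.injective
      change Φ (Φ.symm X * V.ρ h) = Φ (V.ρ h * Φ.symm X)
      rw [map_mul, map_mul, AlgEquiv.apply_symm_apply]
      exact hX h⟩
  let I : Representation.IntertwiningMap V.ρ V.ρ := ⟨LinearMap.id, fun h => by ext; rfl⟩
  by_cases hI : I = 0
  · refine ⟨0, ?_⟩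
    have h0 : (1 : Module.End ℂ V) = 0 := congrArg (fun f => f.toLinearMap) hI
    have h1 : (1 : Matrix (Fin (Module.finrank ℂ V)) (Fin (Module.finrank ℂ V)) ℂ) = 0 := by rw [← map_one Φ, h0, map_zero]
    rw [← mul_one X, h1]; simp
  · obtain ⟨c, hc⟩ := (finrank_eq_one_iff_of_nonzero' I hI).mp hrank T
    refine ⟨c, ?_⟩
    have h0 : c • (1 : Module.End ℂ V) = Φ.symm X := congrArg (fun f => f.toLinearMap) hc
    rw [← AlgEquiv.apply_symm_apply Φ X, ← h0, map_smul, map_one]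

variable [Fintype H] {σ : H →* Matrix ι ι ℂ}

lemma HasScalarCommutant.sum_conj [Nonempty ι] (hσ : HasScalarCommutant σ) (Z : Matrix ι ι ℂ) :
    ∑ h, σ h⁻¹ * Z * σ h = ((Fintype.card H : ℂ) / Fintype.card ι * Z.trace) • 1 := by
  obtain ⟨c, hc⟩ := hσ (∑ h, σ h⁻¹ * Z * σ h) fun k => by
    rw [Finset.sum_mul, Finset.mul_sum, ← Equiv.sum_comp (Equiv.mulRight k)
      (fun h => σ k * (σ h⁻¹ * Z * σ h))]
    refine Finset.sum_congr rfl fun h _ => ?_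
    simp only [Equiv.coe_mulRight, mul_inv_rev, map_mul, ← mul_assoc, map_mul_map_inv, one_mul]
  rw [hc]
  have ht := congrArg Matrix.trace hc
  have hterm : ∀ h, (σ h⁻¹ * Z * σ h).trace = Z.trace := fun h => by
    rw [Matrix.trace_mul_comm, ← mul_assoc, map_mul_map_inv, one_mul]
  simp only [Matrix.trace_sum, hterm, Finset.sum_const, Finset.card_univ, nsmul_eq_mul,
    Matrix.trace_smul, Matrix.trace_one, smul_eq_mul] at ht
  congr 1
  have : (Fintype.card ι : ℂ) ≠ 0 := by simp
  field_simp
  exact ht.symm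

lemma HasScalarCommutant.sum_trace_conj_mul [Nonempty ι] (hσ : HasScalarCommutant σ)
    (Z Y : Matrix ι ι ℂ) :
    ∑ h, (σ h⁻¹ * Z * σ h * Y).trace =
      (Fintype.card H : ℂ) / Fintype.card ι * Z.trace * Y.trace := by
  rw [← Matrix.trace_sum, ← Finset.sum_mul, hσ.sum_conj, Matrix.smul_mul, one_mul,
    Matrix.trace_smul, smul_eq_mul]

lemma trace_mul_trace (P Q : Matrix ι ι ℂ) :
    P.trace * Q.trace = ∑ i : ι, ∑ j : ι, (P * Matrix.single i j (1 : ℂ) * Q) i j := by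
  simp only [Matrix.trace, Matrix.diag_apply, Finset.sum_mul_sum]
  refine Finset.sum_congr rfl fun i _ => Finset.sum_congr rfl fun j _ => ?_
  rw [Matrix.mul_apply, Finset.sum_eq_single j]
  · simp
  · intro k _ hk
    rw [Matrix.mul_single_apply_of_ne _ _ _ _ _ hk, zero_mul]
  · simp

lemma HasScalarCommutant.sum_trace_mul_trace [Nonempty ι] (hσ : HasScalarCommutant σ)
    (X Y : Matrix ι ι ℂ) :
    ∑ h, (σ h⁻¹ * X).trace * (σ h * Y).trace =
      (Fintype.card H : ℂ) / Fintype.card ι * (X * Y).trace := by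
  have key : ∀ i j, ∑ h, (X * σ h⁻¹ * Matrix.single i j (1 : ℂ) * (σ h * Y)) i j =
      (Fintype.card H : ℂ) / Fintype.card ι * ((Matrix.single i j (1 : ℂ)).trace * (X * Y) i j) := by
    intro i j
    have : ∑ h, X * σ h⁻¹ * Matrix.single i j (1 : ℂ) * (σ h * Y) =
        X * (∑ h, σ h⁻¹ * Matrix.single i j (1 : ℂ) * σ h) * Y := by
      simp only [Finset.mul_sum, Finset.sum_mul, mul_assoc]
    rw [← Matrix.sum_apply, this, hσ.sum_conj]
    simp [mul_assoc]
  simp only [Matrix.trace_mul_comm _ X, trace_mul_trace]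
  rw [Finset.sum_comm, Matrix.trace, Finset.mul_sum]
  refine Finset.sum_congr rfl fun i _ => ?_
  rw [Finset.sum_comm]
  simp only [key]
  rw [Finset.sum_eq_single i]
  · simp
  · intro j _ hj
    rw [Matrix.trace_single_eq_of_ne _ _ _ hj.symm, zero_mul, mul_zero]
  · simp

end MatrixRepresentations

section Lifts

open scoped ComplexOrder in
lemma HasScalarCommutant.exists_unit_intertwiner {H : Type} [Group H] [Fintype H]
    {ι : Type} [Fintype ι] [DecidableEq ι] [Nonempty ι] {σ : H →* Matrix ι ι ℂ}
    (hσ : HasScalarCommutant σ) (τ : H →* Matrix ι ι ℂ)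
    (htr : ∀ h, (τ h).trace = (σ h).trace) :
    ∃ A : Matrix ι ι ℂ, IsUnit A ∧ ∀ h, A * σ h = τ h * A := by
  have hcard : (Fintype.card H : ℂ) ≠ 0 := by simp
  have hι : (Fintype.card ι : ℂ) ≠ 0 := by simp
  have hintertwine : ∀ (α β : H →* Matrix ι ι ℂ) (X : Matrix ι ι ℂ) (k : H),
      (∑ h, β h * X * α h⁻¹) * α k = β k * ∑ h, β h * X * α h⁻¹ := by
    intro α β X k
    rw [Finset.sum_mul, Finset.mul_sum, ← Equiv.sum_comp (Equiv.mulLeft k)]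
    refine Finset.sum_congr rfl fun h _ => ?_
    simp only [Equiv.coe_mulLeft, mul_inv_rev, map_mul, mul_assoc, map_inv_mul_map, mul_one]
  obtain ⟨X, hX⟩ : ∃ X : Matrix ι ι ℂ, ∑ h, τ h * X * σ h⁻¹ ≠ 0 := by
    by_contra! h0
    have h1 := hσ.sum_trace_mul_trace 1 1
    simp only [mul_one, Matrix.trace_one] at h1
    rw [div_mul_cancel₀ _ hι] at h1
    refine hcard (h1.symm.trans ?_)
    calc ∑ h, (σ h⁻¹).trace * (σ h).trace
        = ∑ h, ∑ i : ι, ∑ j : ι, (τ h * Matrix.single i j (1 : ℂ) * σ h⁻¹) i j :=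
          Finset.sum_congr rfl fun h _ => by rw [mul_comm, ← htr, trace_mul_trace]
      _ = ∑ i : ι, ∑ j : ι, (∑ h, τ h * Matrix.single i j (1 : ℂ) * σ h⁻¹) i j := by
          rw [Finset.sum_comm]
          refine Finset.sum_congr rfl fun i _ => ?_
          rw [Finset.sum_comm]
          simp only [Matrix.sum_apply]
      _ = 0 := by simp [h0]
  set A := ∑ h, τ h * X * σ h⁻¹ with hA
  have hAint : ∀ h, A * σ h = τ h * A := hintertwine σ τ X
  refine ⟨A, ?_, hAint⟩
  set B := ∑ h, σ h * A.conjTranspose * τ h⁻¹ with hB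
  obtain ⟨c, hc⟩ := hσ (B * A) fun k => by
    rw [mul_assoc, hAint, ← mul_assoc, hintertwine τ σ, mul_assoc]
  have htrace : (B * A).trace = Fintype.card H * (A.conjTranspose * A).trace := by
    rw [hB, Finset.sum_mul, Matrix.trace_sum]
    have : ∀ h, (σ h * A.conjTranspose * τ h⁻¹ * A).trace = (A.conjTranspose * A).trace := by
      intro h
      rw [mul_assoc, ← hAint, ← mul_assoc, Matrix.trace_mul_comm, ← mul_assoc, ← mul_assoc,
        map_inv_mul_map, one_mul]
    simp [this]
  have hc0 : c ≠ 0 := by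
    rintro rfl
    rw [hc, zero_smul, Matrix.trace_zero, eq_comm, mul_eq_zero] at htrace
    refine htrace.elim hcard fun h => hX ?_
    rwa [Matrix.trace_conjTranspose_mul_self_eq_zero_iff] at h
  have : (c⁻¹ • B) * A = 1 := by rw [Matrix.smul_mul, hc, smul_smul, inv_mul_cancel₀ hc0, one_smul]
  exact IsUnit.of_mul_eq_one_right _ this

variable {G : Type} [Group G] {N : Subgroup G} [N.Normal]
  {ι : Type} [Fintype ι] [DecidableEq ι]

/-- `A` implements the conjugation by `g` on the matrix representation `σ` of `N`. -/
def IsLift (σ : N →* Matrix ι ι ℂ) (g : G) (A : (Matrix ι ι ℂ)ˣ) : Prop :=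
  ∀ n : N, (A : Matrix ι ι ℂ) * σ n = σ (MulAut.conjNormal g n) * A

variable {σ : N →* Matrix ι ι ℂ} {g h : G} {A B : (Matrix ι ι ℂ)ˣ}

lemma isLift_one : IsLift σ 1 1 := fun n => by simp

lemma IsLift.mul (hA : IsLift σ g A) (hB : IsLift σ h B) : IsLift σ (g * h) (A * B) := fun n => by
  rw [Units.val_mul, mul_assoc, hB n, ← mul_assoc, hA, mul_assoc, map_mul, MulAut.mul_apply]

lemma IsLift.inv (hA : IsLift σ g A) : IsLift σ g⁻¹ A⁻¹ := fun n => by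
  rw [Units.inv_mul_eq_iff_eq_mul, ← mul_assoc, hA, mul_assoc, Units.mul_inv, mul_one,
    map_inv, MulAut.apply_inv_self]

lemma IsLift.pow (hA : IsLift σ g A) (k : ℕ) : IsLift σ (g ^ k) (A ^ k) := by
  induction k with
  | zero => simpa using isLift_one
  | succ k ih => rw [pow_succ, pow_succ]; exact ih.mul hA

lemma isLift_map (m : N) : IsLift σ m (σ.toHomUnits m) := fun n => by
  rw [MonoidHom.coe_toHomUnits, ← map_mul, ← map_mul]
  congr 1
  ext
  simp

lemma IsLift.mul_toHomUnits (hA : IsLift σ g A) (n : N) :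
    A * σ.toHomUnits n = σ.toHomUnits (MulAut.conjNormal g n) * A :=
  Units.ext (hA n)

lemma IsLift.exists_smul_eq (hσ : HasScalarCommutant σ) (hA : IsLift σ g A) (hB : IsLift σ g B) :
    ∃ c : ℂ, (B : Matrix ι ι ℂ) = c • (A : Matrix ι ι ℂ) := by
  obtain ⟨c, hc⟩ := hσ ((A⁻¹ * B : (Matrix ι ι ℂ)ˣ) : Matrix ι ι ℂ) fun n => by
    have := (hA.inv.mul hB) n
    simpa using this
  refine ⟨c, ?_⟩
  rw [Units.val_mul, Units.inv_mul_eq_iff_eq_mul] at hc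
  rw [hc, Matrix.mul_smul, mul_one]

lemma exists_isLift_det_eq_one [Fintype N] [Nonempty ι] (hσ : HasScalarCommutant σ)
    (hinv : ∀ (g : G) (n : N), (σ (MulAut.conjNormal g n)).trace = (σ n).trace) (g : G) :
    ∃ A : (Matrix ι ι ℂ)ˣ, IsLift σ g A ∧ (A : Matrix ι ι ℂ).det = 1 := by
  obtain ⟨A, hA, hintertwine⟩ := hσ.exists_unit_intertwiner
    (σ.comp (MulAut.conjNormal g : N ≃* N).toMonoidHom) (hinv g)
  have hdet : A.det ≠ 0 := ((Matrix.isUnit_iff_isUnit_det _).mp hA).ne_zero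
  obtain ⟨z, hz⟩ := IsAlgClosed.exists_pow_nat_eq A.det⁻¹ (Fintype.card_pos (α := ι))
  have hdet' : (z • A).det = 1 := by rw [Matrix.det_smul, hz, inv_mul_cancel₀ hdet]
  obtain ⟨U, hU⟩ := (Matrix.isUnit_iff_isUnit_det (z • A)).mpr (by rw [hdet']; exact isUnit_one)
  refine ⟨U, fun n => ?_, by rw [hU, hdet']⟩
  rw [hU, Matrix.smul_mul, Matrix.mul_smul, hintertwine n]
  rfl

lemma isIntegral_trace_of_pow_eq_one {M : Matrix ι ι ℂ} {k : ℕ} (hk : 0 < k) (hM : M ^ k = 1) :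
    IsIntegral ℤ M.trace := by
  rcases isEmpty_or_nonempty ι with _ | _
  · simpa [Matrix.trace] using isIntegral_zero
  rw [Matrix.trace_eq_sum_roots_charpoly]
  refine IsIntegral.multiset_sum fun z hz => ?_
  have hz' : z ∈ spectrum ℂ M :=
    Matrix.mem_spectrum_of_isRoot_charpoly (Polynomial.isRoot_of_mem_roots hz)
  have hzk := spectrum.pow_mem_pow M k hz'
  rw [hM, spectrum.one_eq, Set.mem_singleton_iff] at hzk
  exact .of_pow hk (hzk ▸ isIntegral_one)

lemma IsLift.isIntegral_trace [Finite G] [Nonempty ι] (hσ : HasScalarCommutant σ)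
    (hA : IsLift σ g A) (hdet : (A : Matrix ι ι ℂ).det = 1) :
    IsIntegral ℤ (A : Matrix ι ι ℂ).trace := by
  have h1 := hA.pow (orderOf g)
  rw [pow_orderOf_eq_one] at h1
  obtain ⟨c, hc⟩ := isLift_one.exists_smul_eq hσ h1
  rw [Units.val_pow_eq_pow_val, Units.val_one] at hc
  have h2 := congrArg Matrix.det hc
  rw [Matrix.det_pow, hdet, one_pow, Matrix.det_smul, Matrix.det_one, mul_one] at h2
  refine isIntegral_trace_of_pow_eq_one (k := orderOf g * Fintype.card ι)
    (Nat.mul_pos (orderOf_pos g) Fintype.card_pos) ?_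
  rw [pow_mul, hc, smul_pow, ← h2, one_smul, one_pow]

end Lifts

section TwistedOperators

variable {G : Type} [Group G] {N : Subgroup G} [Fintype N]
  {ι κ : Type} [Fintype ι] [DecidableEq ι] [Fintype κ] [DecidableEq κ]
  (ρ : G →* Matrix κ κ ℂ) (σ : N →* Matrix ι ι ℂ)

/-- The operator `B` for which `ρ g = A ⊗ B` whenever the restriction of `ρ` to `N` is a multiple
of `σ`, and `A` implements the conjugation by `g` on `σ`. -/
def twistedOperator (g : G) (A : (Matrix ι ι ℂ)ˣ) : Matrix κ κ ℂ :=
  ((Fintype.card ι : ℂ) / Fintype.card N) •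
    ∑ n : N, (A * σ.toHomUnits n)⁻¹.val.trace • ρ (g * n)

variable {ρ σ} {g h : G} {A B : (Matrix ι ι ℂ)ˣ}

lemma twistedOperator_eq_smul {c : ℂ}
    (hAB : (B : Matrix ι ι ℂ) = c • (A : Matrix ι ι ℂ)) :
    twistedOperator ρ σ g A = c • twistedOperator ρ σ g B := by
  have hinv : A⁻¹.val = c • B⁻¹.val := by
    rw [← mul_one A⁻¹.val, ← Units.mul_inv B, hAB, ← mul_assoc, Matrix.mul_smul, Units.inv_mul,
      Matrix.smul_mul, one_mul]
  rw [twistedOperator, twistedOperator, smul_comm, Finset.smul_sum (r := c)]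
  congr 1
  refine Finset.sum_congr rfl fun n _ => ?_
  rw [mul_inv_rev, mul_inv_rev, Units.val_mul, Units.val_mul, hinv, Matrix.mul_smul,
    Matrix.trace_smul, smul_assoc]

lemma twistedOperator_mul_map (m : N) :
    twistedOperator ρ σ (g * m) (A * σ.toHomUnits m) = twistedOperator ρ σ g A := by
  rw [twistedOperator, twistedOperator,
    ← Equiv.sum_comp (Equiv.mulLeft m) (fun n => (A * σ.toHomUnits n)⁻¹.val.trace • ρ (g * n))]
  simp only [Equiv.coe_mulLeft, map_mul, mul_assoc, Subgroup.coe_mul]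

variable [N.Normal]

lemma conj_twistedOperator (hB : IsLift σ h B) :
    ρ h * twistedOperator ρ σ g A * ρ h⁻¹ = twistedOperator ρ σ (h * g * h⁻¹) (B * A * B⁻¹) := by
  rw [twistedOperator, twistedOperator, Matrix.mul_smul, Matrix.smul_mul, Finset.mul_sum,
    Finset.sum_mul, ← Equiv.sum_comp (MulAut.conjNormal h : N ≃* N).toEquiv
      (fun n => (B * A * B⁻¹ * σ.toHomUnits n)⁻¹.val.trace • ρ (h * g * h⁻¹ * n))]
  congr 1
  refine Finset.sum_congr rfl fun n _ => ?_
  rw [Matrix.mul_smul, Matrix.smul_mul, ← map_mul, ← map_mul]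
  congr 1
  · have : B * A * B⁻¹ * σ.toHomUnits (MulAut.conjNormal h n) =
        B * (A * σ.toHomUnits n) * B⁻¹ := by
      rw [eq_mul_inv_iff_mul_eq, mul_assoc _ _ B, ← hB.mul_toHomUnits]
      group
    change _ = (B * A * B⁻¹ * σ.toHomUnits (MulAut.conjNormal h n))⁻¹.val.trace
    rw [this, mul_inv_rev _ B⁻¹, mul_inv_rev B, inv_inv, ← mul_assoc, Units.val_mul,
      Matrix.trace_mul_comm, ← Units.val_mul, ← mul_assoc, inv_mul_cancel, one_mul]
  · congr 1
    change _ = _ * (MulAut.conjNormal h n : G)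
    rw [MulAut.conjNormal_apply]
    group

lemma twistedOperator_mul [Nonempty ι] (hσ : HasScalarCommutant σ) (hB : IsLift σ h B) :
    twistedOperator ρ σ g A * twistedOperator ρ σ h B = twistedOperator ρ σ (g * h) (A * B) := by
  have hι : (Fintype.card ι : ℂ) ≠ 0 := by simp
  have hN : (Fintype.card N : ℂ) ≠ 0 := by simp
  have hreindex : ∀ n : N,
      ((A * σ.toHomUnits n)⁻¹.val.trace • ρ (g * n)) *
        ∑ m : N, (B * σ.toHomUnits m)⁻¹.val.trace • ρ (h * m) =
      ∑ k : N, ((σ n⁻¹ * A⁻¹.val).trace * (σ n * (B * σ.toHomUnits k)⁻¹.val).trace) •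
        ρ (g * h * k) := by
    intro n
    rw [Finset.mul_sum, ← Equiv.sum_comp (Equiv.mulLeft (MulAut.conjNormal h⁻¹ n)⁻¹)]
    refine Finset.sum_congr rfl fun k _ => ?_
    rw [smul_mul_smul_comm, ← map_mul, Equiv.coe_mulLeft]
    congr 2
    · have hconj := hB.mul_toHomUnits (MulAut.conjNormal h⁻¹ n)
      rw [← MulAut.mul_apply, ← map_mul, mul_inv_cancel, map_one, MulAut.one_apply] at hconj
      have : B * σ.toHomUnits ((MulAut.conjNormal h⁻¹ n)⁻¹ * k) =
          (σ.toHomUnits n)⁻¹ * (B * σ.toHomUnits k) := by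
        rw [map_mul, map_inv, eq_inv_mul_iff_mul_eq, ← mul_assoc, ← mul_assoc, ← hconj]
        group
      rw [this, mul_inv_rev, inv_inv, Units.val_mul, Matrix.trace_mul_comm,
        MonoidHom.coe_toHomUnits]
    · simp only [Subgroup.coe_mul, InvMemClass.coe_inv, MulAut.conjNormal_apply]
      group
  simp only [twistedOperator]
  rw [smul_mul_smul_comm, Finset.sum_mul]
  simp only [hreindex]
  rw [Finset.sum_comm]
  simp only [← Finset.sum_smul, hσ.sum_trace_mul_trace]
  rw [mul_smul]
  congr 1
  rw [Finset.smul_sum]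
  refine Finset.sum_congr rfl fun k _ => ?_
  rw [smul_smul]
  congr 1
  rw [Matrix.trace_mul_comm, ← Units.val_mul, ← mul_inv_rev, mul_assoc]
  field_simp

lemma sum_conj_eq_twistedOperator [Nonempty ι] (hσ : HasScalarCommutant σ) (hA : IsLift σ g A)
    (hone : twistedOperator ρ σ 1 1 = 1) :
    ∑ m : N, ρ m * ρ g * ρ (m : G)⁻¹ =
      ((Fintype.card N : ℂ) / Fintype.card ι * (A : Matrix ι ι ℂ).trace) •
        twistedOperator ρ σ g A := by
  have hι : (Fintype.card ι : ℂ) ≠ 0 := by simp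
  have hN : (Fintype.card N : ℂ) ≠ 0 := by simp
  have hreindex : ∀ m : N, ρ m * ρ g * ρ (m : G)⁻¹ =
      ((Fintype.card ι : ℂ) / Fintype.card N) • ∑ k : N,
        (σ m⁻¹ * (A * σ.toHomUnits k)⁻¹.val * σ m * A.val).trace • ρ (g * k) := by
    intro m
    rw [← mul_one (ρ g), ← hone, twistedOperator, Matrix.mul_smul, Matrix.mul_smul,
      Matrix.smul_mul, Finset.mul_sum, Finset.mul_sum, Finset.sum_mul,
      ← Equiv.sum_comp ((Equiv.mulLeft (MulAut.conjNormal g⁻¹ m)⁻¹).trans (Equiv.mulRight m))]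
    congr 1
    refine Finset.sum_congr rfl fun k _ => ?_
    rw [Matrix.mul_smul, Matrix.mul_smul, Matrix.smul_mul, ← map_mul, ← map_mul, ← map_mul,
      Equiv.trans_apply, Equiv.coe_mulLeft, Equiv.coe_mulRight]
    congr 2
    · have hconj := hA.mul_toHomUnits (MulAut.conjNormal g⁻¹ m)
      rw [← MulAut.mul_apply, ← map_mul, mul_inv_cancel, map_one, MulAut.one_apply,
        ← eq_inv_mul_iff_mul_eq] at hconj
      have : (1 * σ.toHomUnits ((MulAut.conjNormal g⁻¹ m)⁻¹ * k * m))⁻¹ =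
          σ.toHomUnits m⁻¹ * (A * σ.toHomUnits k)⁻¹ * σ.toHomUnits m * A := by
        rw [map_mul, map_mul, map_inv, hconj, map_inv]
        group
      rw [this]
      simp only [Units.val_mul, MonoidHom.coe_toHomUnits]
    · simp only [Subgroup.coe_mul, InvMemClass.coe_inv, MulAut.conjNormal_apply]
      group
  simp only [hreindex]
  rw [← Finset.smul_sum, Finset.sum_comm]
  simp only [← Finset.sum_smul, hσ.sum_trace_conj_mul]
  rw [twistedOperator, smul_comm,
    Finset.smul_sum (r := (Fintype.card N : ℂ) / Fintype.card ι * A.val.trace)]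
  congr 1
  refine Finset.sum_congr rfl fun k _ => ?_
  rw [smul_smul]
  congr 1
  ring

end TwistedOperators

section CentralCharacter

variable {G : Type} [Group G] {κ : Type} [Fintype κ] [DecidableEq κ]
  {ρ : G →* Matrix κ κ ℂ}

lemma HasScalarCommutant.exists_sum_quotient_eq_smul (hρ : HasScalarCommutant ρ) (C : Subgroup G)
    [Fintype (G ⧸ C)] (T : Matrix κ κ ℂ) (hT : ∀ c ∈ C, ρ c * T * ρ c⁻¹ = T) :
    ∃ z : ℂ, ∑ q : G ⧸ C, ρ q.out * T * ρ q.out⁻¹ = z • 1 ∧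
      (C.index : ℂ) * T.trace = z * Fintype.card κ := by
  have hout : ∀ g : G, ρ (g : G ⧸ C).out * T * ρ (g : G ⧸ C).out⁻¹ = ρ g * T * ρ g⁻¹ := by
    intro g
    obtain ⟨c, hc⟩ := QuotientGroup.mk_out_eq_mul C g
    have hTc := hT c c.2
    rw [hc, mul_inv_rev, map_mul, map_mul]
    calc ρ g * ρ c * T * (ρ (c : G)⁻¹ * ρ g⁻¹) = ρ g * (ρ c * T * ρ (c : G)⁻¹) * ρ g⁻¹ := by
          simp only [mul_assoc]
      _ = _ := by rw [hTc]
  obtain ⟨z, hz⟩ := hρ (∑ q : G ⧸ C, ρ q.out * T * ρ q.out⁻¹) fun h => by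
    rw [Finset.sum_mul, Finset.mul_sum, ← Equiv.sum_comp (MulAction.toPerm h)]
    refine Finset.sum_congr rfl fun q _ => ?_
    have hq : (MulAction.toPerm h) q = ((h * q.out : G) : G ⧸ C) := by
      conv_lhs => rw [← QuotientGroup.out_eq' q]
      rfl
    rw [hq, hout, mul_inv_rev, map_mul, map_mul]
    simp only [mul_assoc, map_inv_mul_map, mul_one]
  refine ⟨z, hz, ?_⟩
  have ht := congrArg Matrix.trace hz
  have hterm : ∀ g, (ρ g * T * ρ g⁻¹).trace = T.trace := fun g => by
    rw [Matrix.trace_mul_comm, ← mul_assoc, map_inv_mul_map, one_mul]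
  simp only [Matrix.trace_sum, hterm, Finset.sum_const, Finset.card_univ, nsmul_eq_mul,
    Matrix.trace_smul, Matrix.trace_one, smul_eq_mul] at ht
  rwa [Subgroup.index_eq_card, Nat.card_eq_fintype_card]

variable {N : Subgroup G} [N.Normal] [Fintype N] {ι : Type} [Fintype ι] [DecidableEq ι]
  [Nonempty ι] {σ : N →* Matrix ι ι ℂ}

lemma twistedOperator_one_eq_one (hρ : HasScalarCommutant ρ) (hσ : HasScalarCommutant σ)
    (hinv : ∀ (g : G) (n : N), (σ (MulAut.conjNormal g n)).trace = (σ n).trace)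
    (hover : ∑ n : N, (ρ n).trace * (σ n⁻¹).trace ≠ 0) :
    twistedOperator ρ σ (1 : G) 1 = 1 := by
  obtain ⟨c, hc⟩ := hρ (twistedOperator ρ σ (1 : G) 1) fun h => by
    obtain ⟨B, hB, -⟩ := exists_isLift_det_eq_one hσ hinv h
    have h1 := conj_twistedOperator (ρ := ρ) (g := 1) (A := 1) hB
    rw [mul_one, mul_inv_cancel, mul_one, mul_inv_cancel] at h1
    calc _ = ρ h * twistedOperator ρ σ (1 : G) 1 * ρ h⁻¹ * ρ h := by rw [h1]
      _ = _ := by rw [mul_assoc, map_inv_mul_map, mul_one]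
  have hne : twistedOperator ρ σ (1 : G) 1 ≠ 0 := by
    intro h0
    have h1 := congrArg Matrix.trace h0
    rw [twistedOperator, Matrix.trace_smul, Matrix.trace_sum, Matrix.trace_zero, smul_eq_mul,
      mul_eq_zero] at h1
    refine h1.elim (by simp) fun h2 => hover ?_
    rw [← h2]
    refine Finset.sum_congr rfl fun n _ => ?_
    rw [Matrix.trace_smul, smul_eq_mul, mul_comm, one_mul, one_mul, ← map_inv,
      MonoidHom.coe_toHomUnits]
  have hidem := twistedOperator_mul (ρ := ρ) (g := 1) (A := 1) hσ isLift_one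
  rw [mul_one, mul_one] at hidem
  nth_rewrite 1 [hc] at hidem
  rw [Matrix.smul_mul, one_mul, ← sub_eq_zero] at hidem
  have hc1 : (c - 1) • twistedOperator ρ σ (1 : G) 1 = 0 := by rw [sub_smul, one_smul, hidem]
  rw [hc, sub_eq_zero.mp ((smul_eq_zero.mp hc1).resolve_right hne), one_smul]

/-- The integrality of relative central characters, for matrix representations. -/
lemma isIntegral_relative_central_character [Finite G] (hρ : HasScalarCommutant ρ)
    (hσ : HasScalarCommutant σ)
    (hinv : ∀ (g : G) (n : N), (σ (MulAut.conjNormal g n)).trace = (σ n).trace)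
    (hover : ∑ n : N, (ρ n).trace * (σ n⁻¹).trace ≠ 0) (x : G) (C : Subgroup G)
    (hC : ∀ c ∈ C, x⁻¹ * (c * x * c⁻¹) ∈ N) :
    IsIntegral ℤ ((σ 1).trace * (C.index : ℂ) * (ρ x).trace / (ρ 1).trace) := by
  have hι : (Fintype.card ι : ℂ) ≠ 0 := by simp
  have hN : (Fintype.card N : ℂ) ≠ 0 := by simp
  have hone := twistedOperator_one_eq_one hρ hσ hinv hover
  have hκ : (Fintype.card κ : ℂ) ≠ 0 := by
    intro h0
    have : IsEmpty κ := by simpa [Fintype.card_eq_zero_iff] using h0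
    exact hover (by simp [Matrix.trace])
  choose A hA hdet using exists_isLift_det_eq_one hσ hinv
  set T := twistedOperator ρ σ x (A x) with hTdef
  have htrace : (Fintype.card ι : ℂ) * (ρ x).trace = (A x).val.trace * T.trace := by
    have h1 := congrArg Matrix.trace (sum_conj_eq_twistedOperator hσ (hA x) hone)
    have hterm : ∀ m : N, (ρ m * ρ x * ρ (m : G)⁻¹).trace = (ρ x).trace := fun m => by
      rw [Matrix.trace_mul_comm, ← mul_assoc, map_inv_mul_map, one_mul]
    simp only [Matrix.trace_sum, hterm, Finset.sum_const, Finset.card_univ, nsmul_eq_mul,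
      Matrix.trace_smul, smul_eq_mul] at h1
    field_simp at h1
    linear_combination h1
  rw [map_one, map_one, Matrix.trace_one, Matrix.trace_one]
  have hgoal : (Fintype.card ι : ℂ) * C.index * (ρ x).trace / Fintype.card κ =
      (A x).val.trace * (C.index * T.trace / Fintype.card κ) := by
    rw [mul_right_comm, htrace]; ring
  rw [hgoal]
  refine ((hA x).isIntegral_trace hσ (hdet x)).mul ?_
  by_cases hT0 : T.trace = 0
  · rw [hT0, mul_zero, zero_div]; exact isIntegral_zero
  have hTC : ∀ c ∈ C, ρ c * T * ρ c⁻¹ = T := by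
    intro c hc
    let n : N := ⟨x⁻¹ * (c * x * c⁻¹), hC c hc⟩
    have hn : c * x * c⁻¹ = x * n := by simp [n]
    have h1 := conj_twistedOperator (ρ := ρ) (g := x) (A := A x) (hA c)
    have h2 : IsLift σ (x * n) (A c * A x * (A c)⁻¹) := by
      rw [← hn]; exact ((hA c).mul (hA x)).mul (hA c).inv
    obtain ⟨z, hz⟩ := h2.exists_smul_eq hσ ((hA x).mul (isLift_map n))
    rw [hn, twistedOperator_eq_smul hz, twistedOperator_mul_map, ← hTdef] at h1
    have h3 := congrArg Matrix.trace h1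
    rw [Matrix.trace_mul_comm, ← mul_assoc, map_inv_mul_map, one_mul, Matrix.trace_smul,
      smul_eq_mul] at h3
    have hz1 : z = 1 := by
      refine mul_right_cancel₀ hT0 ?_
      rw [one_mul, ← h3]
    rw [h1, hz1, one_smul]
  have : Fintype (G ⧸ C) := Fintype.ofFinite _
  obtain ⟨z, hz, hzt⟩ := hρ.exists_sum_quotient_eq_smul C T hTC
  rw [hzt, mul_div_cancel_right₀ _ hκ]
  let O := integralClosure ℤ ℂ
  let M : Submodule O (Matrix κ κ ℂ) :=
    Submodule.span O (Set.range fun g => twistedOperator ρ σ g (A g))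
  have hmem : ∀ (g : G) (B : (Matrix ι ι ℂ)ˣ), IsLift σ g B → B.val.det = 1 →
      twistedOperator ρ σ g B ∈ M := by
    intro g B hB hBdet
    obtain ⟨c, hc⟩ := hB.exists_smul_eq hσ (hA g)
    have hcpow := congrArg Matrix.det hc
    rw [hdet, Matrix.det_smul, hBdet, mul_one] at hcpow
    have hcint : IsIntegral ℤ c := .of_pow Fintype.card_pos (hcpow ▸ isIntegral_one)
    rw [twistedOperator_eq_smul hc]
    exact M.smul_mem (⟨c, hcint⟩ : O) (Submodule.subset_span ⟨g, rfl⟩)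
  have hMne : M ≠ ⊥ := by
    intro h0
    have h1 := hmem 1 1 isLift_one (by simp)
    rw [h0, hone, Submodule.mem_bot] at h1
    have h2 := congrArg Matrix.trace h1
    rw [Matrix.trace_one, Matrix.trace_zero] at h2
    exact hκ h2
  have hdetinv : ∀ g, (A g)⁻¹.val.det = 1 := fun g => by
    have := congrArg Matrix.det (A g).mul_inv
    rwa [Matrix.det_mul, hdet, one_mul, Matrix.det_one] at this
  have hz_int : IsIntegral O z := by
    refine isIntegral_of_smul_mem_submodule M hMne
      (Submodule.fg_span (Set.finite_range _)) z fun m hm => ?_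
    induction hm using Submodule.span_induction with
    | zero => rw [smul_zero]; exact M.zero_mem
    | add a b _ _ ha hb => rw [smul_add]; exact M.add_mem ha hb
    | smul r a _ ha => rw [smul_comm]; exact M.smul_mem r ha
    | mem a ha =>
      obtain ⟨g, rfl⟩ := ha
      have : z • twistedOperator ρ σ g (A g) =
          (∑ q : G ⧸ C, ρ q.out * T * ρ q.out⁻¹) * twistedOperator ρ σ g (A g) := by
        rw [hz, Matrix.smul_mul, one_mul]
      change z • twistedOperator ρ σ g (A g) ∈ M
      rw [this, Finset.sum_mul]
      refine M.sum_mem fun q _ => ?_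
      rw [hTdef, conj_twistedOperator (hA q.out), twistedOperator_mul hσ (hA g)]
      refine hmem _ _ ((((hA _).mul (hA x)).mul (hA _).inv).mul (hA g)) ?_
      simp only [Units.val_mul, Matrix.det_mul, hdet, hdetinv, mul_one]
  exact isIntegral_trans z hz_int

end CentralCharacter

theorem relative_centralizer_algebraic_integer {G : Type} [Group G] [Finite G]
    (N : Subgroup G) [N.Normal] (θ : ↥N → ℂ)
    (hθ : IsIrrChar ↥N θ) (hinv : IsGInvariant N θ)
    (χ : G → ℂ) (hχ : IsIrrChar G χ)
    (hover : charInner ↥N (fun n : ↥N => χ (n : G)) θ ≠ 0) (x : G) :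
    IsIntegral ℤ (θ 1 * (((Subgroup.centralizer {((x : G) : G ⧸ N)}).comap
      (QuotientGroup.mk' N)).index : ℂ) * χ x / χ 1) := by
  have : Fintype G := Fintype.ofFinite G
  have : Fintype N := Fintype.ofFinite N
  obtain ⟨e, σ, rfl, hσ⟩ := exists_matrix_representation hθ
  obtain ⟨d, ρ, rfl, hρ⟩ := exists_matrix_representation hχ
  have hover' : ∑ n : N, (ρ n).trace * (σ n⁻¹).trace ≠ 0 := by
    intro h0
    refine hover ((charInner_trace (ρ.comp N.subtype) σ).trans ?_)
    simp [h0]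
  have : Nonempty (Fin e) := by
    by_contra hempty
    rw [not_nonempty_iff] at hempty
    exact hover' (by simp [Matrix.trace])
  refine isIntegral_relative_central_character hρ hσ (fun g n => hinv g n) hover' x _
    fun c hc => ?_
  rw [Subgroup.mem_comap, Subgroup.mem_centralizer_singleton_iff] at hc
  have hcx : ((c * x : G) : G ⧸ N) = ((x * c : G) : G ⧸ N) := by
    simpa using hc
  rw [← QuotientGroup.eq, QuotientGroup.mk_mul, hcx, ← QuotientGroup.mk_mul, mul_inv_cancel_right]
end
end

section
/- Let G be a finite group with a normal subgroup N, and suppose N is a π-group and θ ∈ Irr(N) is G-invariant. For each element g ∈ G whose π-part lies in N (equivalently, Ng is a π'-element of G/N), let θ_g denote the unique extension of θ to N⟨g⟩ with determinantal order o(θ_g) = o(θ), and define θ̂(g) = θ_g(g). Then θ̂ is constant on each conjugacy class of the set G⁰ = {g ∈ G : g_π ∈ N}, i.e., θ̂(x^h) = θ̂(x) for all x ∈ G⁰ and h ∈ G. -/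
open scoped BigOperators
noncomputable section

/-- The determinantal order of a finite-dimensional complex representation:
the smallest positive `m` with `det(ρ h)^m = 1` for all `h`. -/
def detOrder {H : Type} [Group H] (V : FDRep ℂ H) : ℕ :=
  sInf {m | 0 < m ∧ ∀ h : H, (LinearMap.det (V.ρ h)) ^ m = 1}

/-- `φ` is the canonical extension of `θ` to `H`: a character of `H` extending `θ`
whose determinantal order equals that of `θ`. -/
def IsCanonicalExtension {G : Type} [Group G] {N H : Subgroup G} (hNH : N ≤ H)
    (θ : ↥N → ℂ) (φ : ↥H → ℂ) : Prop :=
  (∀ n : ↥N, φ (Subgroup.inclusion hNH n) = θ n) ∧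
  ∃ (V : FDRep ℂ ↥H) (W : FDRep ℂ ↥N), (∀ h, φ h = V.character h) ∧
    (∀ n, θ n = W.character n) ∧ detOrder V = detOrder W

open Module

theorem LinearMap.trace_eq_conj_trace_of_mul_eq_one {V : Type*} [AddCommGroup V] [Module ℂ V]
    [FiniteDimensional ℂ V] {f g : End ℂ V} {n : ℕ} (hn : n ≠ 0) (hf : f ^ n = 1)
    (hgf : g * f = 1) : trace ℂ V g = starRingEnd ℂ (trace ℂ V f) := by
  classical
  have hss : f.IsSemisimple := by
    refine Module.End.isSemisimple_of_squarefree_aeval_eq_zero (p := Polynomial.X ^ n - 1) ?_ ?_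
    · exact ((Polynomial.X_pow_sub_one_separable_iff).2 (by exact_mod_cast hn)).squarefree
    · simp [hf]
  have htop : ⨆ μ, f.eigenspace μ = ⊤ := by
    rw [← f.iSup_maxGenEigenspace_eq_top]
    simp [hss.isFinitelySemisimple.maxGenEigenspace_eq_eigenspace]
  have hinternal : DirectSum.IsInternal f.eigenspace :=
    DirectSum.isInternal_submodule_of_iSupIndep_of_iSup_eq_top f.eigenspaces_iSupIndep htop
  have hfin : {μ | f.eigenspace μ ≠ ⊥}.Finite :=
    WellFoundedGT.finite_ne_bot_of_iSupIndep f.eigenspaces_iSupIndep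
  have hμ : ∀ μ v, v ∈ f.eigenspace μ → v ≠ 0 → μ ^ n = 1 := by
    intro μ v hv hv0
    have h1 := (End.HasEigenvector.pow_apply ⟨hv, hv0⟩ n : (f ^ n) v = μ ^ n • v)
    rw [hf, End.one_apply] at h1
    have : (μ ^ n - 1) • v = 0 := by rw [sub_smul, ← h1, one_smul, sub_self]
    exact sub_eq_zero.1 ((smul_eq_zero.1 this).resolve_right hv0)
  have hg : ∀ μ v, v ∈ f.eigenspace μ → g v = starRingEnd ℂ μ • v := by
    intro μ v hv
    rcases eq_or_ne v 0 with rfl | hv0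
    · simp
    have h1 : g (f v) = v := LinearMap.congr_fun hgf v
    rw [End.mem_eigenspace_iff.1 hv, map_smul] at h1
    rw [← Complex.inv_eq_conj (Complex.norm_eq_one_of_pow_eq_one (hμ μ v hv hv0) hn)]
    nth_rw 2 [← h1]
    rw [smul_smul, inv_mul_cancel₀, one_smul]
    rintro rfl
    simpa [hn] using hμ 0 v hv hv0
  have hmf : ∀ μ, Set.MapsTo f (f.eigenspace μ) (f.eigenspace μ) := fun μ v hv ↦ by
    rw [End.mem_eigenspace_iff.1 hv]; exact Submodule.smul_mem _ _ hv
  have hmg : ∀ μ, Set.MapsTo g (f.eigenspace μ) (f.eigenspace μ) := fun μ v hv ↦ by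
    rw [hg μ v hv]; exact Submodule.smul_mem _ _ hv
  rw [trace_eq_sum_trace_restrict' hinternal hfin hmf, trace_eq_sum_trace_restrict' hinternal hfin hmg,
    map_sum]
  refine Finset.sum_congr rfl fun μ _ ↦ ?_
  have e1 : f.restrict (hmf μ) = μ • LinearMap.id := by
    ext v; exact End.mem_eigenspace_iff.1 v.2
  have e2 : g.restrict (hmg μ) = starRingEnd ℂ μ • LinearMap.id := by
    ext v; exact hg μ v v.2
  rw [e1, e2, map_smul, map_smul, trace_id]
  simp

theorem LinearMap.isIntegral_trace_of_pow_eq_one {K V : Type*} [Field K] [IsAlgClosed K]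
    [AddCommGroup V] [Module K V] [FiniteDimensional K V] {f : End K V} {n : ℕ} (hn : n ≠ 0)
    (hf : f ^ n = 1) : IsIntegral ℤ (trace K V f) := by
  rw [End.trace_eq_sum_roots_charpoly_of_splits (IsAlgClosed.splits _)]
  refine IsIntegral.multiset_sum fun μ hμ ↦ ?_
  have h := (End.hasEigenvalue_iff_isRoot_charpoly f μ).2 (Polynomial.isRoot_of_mem_roots hμ)
  obtain ⟨v, hv⟩ := h.exists_hasEigenvector
  have h1 := hv.pow_apply n
  rw [hf, End.one_apply] at h1
  have h2 : (μ ^ n - 1) • v = 0 := by rw [sub_smul, ← h1, one_smul, sub_self]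
  refine IsIntegral.of_pow (Nat.pos_of_ne_zero hn) ?_
  rw [sub_eq_zero.1 ((smul_eq_zero.1 h2).resolve_right hv.2)]
  exact isIntegral_one

theorem Subgroup.exists_monoidHom_sup_zpowers {G H : Type*} [Group G] [Group H] (N : Subgroup G)
    [N.Normal] (x : G) (f : N →* H) (t : H)
    (hconj : ∀ n : N, f (MulAut.conjNormal x n) = t * f n * t⁻¹)
    (hzpow : ∀ (k : ℤ) (hk : x ^ k ∈ N), f ⟨x ^ k, hk⟩ = t ^ k) :
    ∃ F : ↥(N ⊔ Subgroup.zpowers x) →* H,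
      (∀ n : N, F (Subgroup.inclusion le_sup_left n) = f n) ∧
      F ⟨x, Subgroup.mem_sup_right (Subgroup.mem_zpowers x)⟩ = t := by
  let φ : Multiplicative ℤ →* MulAut N := MulAut.conjNormal.comp (zpowersHom G x)
  let x' : ↥(N ⊔ Subgroup.zpowers x) := ⟨x, Subgroup.mem_sup_right (Subgroup.mem_zpowers x)⟩
  have hφ : ∀ k n, f (φ k n) = t ^ k.toAdd * f n * (t ^ k.toAdd)⁻¹ := by
    have key : ∀ (k : ℤ) (n : N),
        f (MulAut.conjNormal (x ^ k) n) = t ^ k * f n * (t ^ k)⁻¹ := by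
      intro k
      induction k with
      | zero => simp
      | succ k ih =>
        intro n
        rw [zpow_add_one, map_mul, MulAut.mul_apply, ih, hconj, zpow_add_one]
        group
      | pred k ih =>
        intro n
        have := hconj (MulAut.conjNormal x⁻¹ n)
        rw [← MulAut.mul_apply, ← map_mul, mul_inv_cancel, map_one, MulAut.one_apply] at this
        rw [zpow_sub_one, map_mul, MulAut.mul_apply, ih, zpow_sub_one, this]
        group
    exact fun k n ↦ key k.toAdd n
  let P : N ⋊[φ] Multiplicative ℤ →* ↥(N ⊔ Subgroup.zpowers x) :=
    SemidirectProduct.lift (Subgroup.inclusion le_sup_left) (zpowersHom _ x') (by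
      intro k
      ext n
      simp [φ, x', -map_zpow, MulAut.conjNormal_apply])
  let Q : N ⋊[φ] Multiplicative ℤ →* H :=
    SemidirectProduct.lift f (zpowersHom _ t) (by
      intro k
      ext n
      simp [hφ, -map_zpow])
  have hP : Function.Surjective P := by
    rintro ⟨y, hy⟩
    obtain ⟨n, hn, z, ⟨k, rfl⟩, rfl⟩ := Subgroup.mem_sup_of_normal_left.1 hy
    refine ⟨⟨⟨n, hn⟩, Multiplicative.ofAdd k⟩, ?_⟩
    ext
    simp [P, SemidirectProduct.lift, x']
  have hker : P.ker ≤ Q.ker := by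
    rintro ⟨n, k⟩ h
    have h1 : (n : G) * x ^ k.toAdd = 1 := by
      simpa [P, SemidirectProduct.lift, x', Subtype.ext_iff] using h
    have h2 : x ^ k.toAdd = ((n⁻¹ : N) : G) := by simpa using eq_inv_of_mul_eq_one_right h1
    have h3 := hzpow k.toAdd (h2 ▸ n⁻¹.2)
    have h4 : (⟨x ^ k.toAdd, h2 ▸ n⁻¹.2⟩ : N) = n⁻¹ := Subtype.ext h2
    rw [h4] at h3
    simp [Q, SemidirectProduct.lift, MonoidHom.mem_ker, ← h3]
  refine ⟨(P.liftOfSurjective hP) ⟨Q, hker⟩, fun n ↦ ?_, ?_⟩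
  · have := P.liftOfRightInverse_comp_apply _ (Function.rightInverse_surjInv hP) ⟨Q, hker⟩
      (SemidirectProduct.inl n)
    simpa [P, Q] using this
  · have := P.liftOfRightInverse_comp_apply _ (Function.rightInverse_surjInv hP) ⟨Q, hker⟩
      (SemidirectProduct.inr (Multiplicative.ofAdd 1))
    simpa [P, Q] using this

namespace FDRep

open CategoryTheory

theorem character_inv {G : Type} [Group G] [Finite G] (V : FDRep ℂ G) (g : G) :
    V.character g⁻¹ = starRingEnd ℂ (V.character g) :=
  LinearMap.trace_eq_conj_trace_of_mul_eq_one (n := Nat.card G) Nat.card_pos.ne'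
    (by rw [← map_pow, pow_card_eq_one', map_one]) (by rw [← map_mul, inv_mul_cancel, map_one])

theorem isIntegral_character {G : Type} [Group G] [Finite G] (V : FDRep ℂ G) (g : G) :
    IsIntegral ℤ (V.character g) :=
  LinearMap.isIntegral_trace_of_pow_eq_one (n := Nat.card G) Nat.card_pos.ne'
    (by rw [← map_pow, pow_card_eq_one', map_one])

theorem nontrivial_of_simple {G : Type} [Group G] (V : FDRep ℂ G) [Simple V] : Nontrivial V := by
  by_contra h
  rw [not_nontrivial_iff_subsingleton] at h
  apply Simple.not_isZero V
  rw [Limits.IsZero.iff_id_eq_zero]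
  ext v
  exact Subsingleton.elim (α := V) _ _

theorem exists_smul_one_of_commute {G : Type} [Group G] (V : FDRep ℂ G) [Simple V] (f : End ℂ V)
    (hf : ∀ g, Commute f (V.ρ g)) : ∃ c : ℂ, f = c • 1 := by
  have hmem : ∀ f : End ℂ V, (∀ g, Commute f (V.ρ g)) →
      f ∈ (Representation.linHom V.ρ V.ρ).invariants := by
    intro f hf g
    change V.ρ g * (f * V.ρ g⁻¹) = f
    rw [← mul_assoc, ← (hf g).eq, mul_assoc, ← map_mul, mul_inv_cancel, map_one, mul_one]
  have hrank : finrank ℂ (Representation.linHom V.ρ V.ρ).invariants = 1 := by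
    rw [(Representation.linHom.invariantsEquivFDRepHom V V).finrank_eq]
    exact finrank_endomorphism_simple_eq_one ℂ V
  have := V.nontrivial_of_simple
  have hone : (⟨1, hmem 1 fun g ↦ Commute.one_left _⟩ :
      (Representation.linHom V.ρ V.ρ).invariants) ≠ 0 :=
    fun h ↦ one_ne_zero (congrArg Subtype.val h)
  obtain ⟨c, hc⟩ := (finrank_eq_one_iff_of_nonzero' _ hone).1 hrank ⟨f, hmem f hf⟩
  exact ⟨c, (congrArg Subtype.val hc).symm⟩

theorem exists_linearEquiv_of_character_comp_eq {G : Type} [Group G] [Finite G] (V : FDRep ℂ G)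
    [Simple V] (α : G ≃* G) (hα : ∀ g, V.character (α g) = V.character g) :
    ∃ T : (V : Type) ≃ₗ[ℂ] V, ∀ g, V.ρ (α g) = T.conj (V.ρ g) := by
  have := Fintype.ofFinite G
  let W : FDRep ℂ G := FDRep.of (V := V) (V.ρ.comp α.toMonoidHom)
  have hW : ∀ g, W.character g = V.character g := hα
  have : Simple W := by
    rw [simple_iff_char_is_norm_one]
    simpa only [hW] using (simple_iff_char_is_norm_one V).1 inferInstance
  have : Invertible (Nat.card G : ℂ) := invertibleOfNonzero (NeZero.ne _)
  have h := char_orthonormal V W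
  simp only [hW, (simple_iff_char_is_norm_one V).1 inferInstance,
    inv_mul_cancel_of_invertible] at h
  split_ifs at h with hne
  · obtain ⟨i⟩ := hne
    let T : (V : Type) ≃ₗ[ℂ] W := isoToLinearEquiv i
    exact ⟨T, Iso.conj_ρ i⟩
  · simp at h

theorem finrank_dvd_card {G : Type} [Group G] [Finite G] (V : FDRep ℂ G) [Simple V] :
    finrank ℂ V ∣ Nat.card G := by
  classical
  have := Fintype.ofFinite G
  have := V.nontrivial_of_simple
  let R := integralClosure ℤ ℂ
  let χ : G → R := fun g ↦ ⟨V.character g, V.isIntegral_character g⟩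
  let a : MonoidAlgebra R G := ∑ g, MonoidAlgebra.single g (χ g⁻¹)
  let F : MonoidAlgebra R G →ₐ[R] End ℂ V := MonoidAlgebra.lift R (End ℂ V) G V.ρ
  have hFa : F a = ∑ g, V.character g⁻¹ • V.ρ g := by
    simp only [a, F, map_sum, MonoidAlgebra.lift_single]
    rfl
  have hcomm : ∀ h, Commute (F a) (V.ρ h) := by
    intro h
    rw [hFa, Commute, SemiconjBy, Finset.sum_mul, Finset.mul_sum]
    refine Fintype.sum_equiv (MulAut.conj h⁻¹).toEquiv _ _ fun g ↦ ?_
    simp only [smul_mul_assoc, mul_smul_comm, ← map_mul, MulEquiv.toEquiv_eq_coe,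
      EquivLike.coe_coe, MulAut.conj_apply, mul_inv_rev, inv_inv]
    rw [← mul_assoc h⁻¹, V.char_mul_comm]
    simp [mul_assoc]
  obtain ⟨c, hc⟩ := V.exists_smul_one_of_commute _ hcomm
  have hmul : c * finrank ℂ V = Nat.card G := by
    have h1 := congrArg (LinearMap.trace ℂ V) hc
    rw [hFa, map_smul, LinearMap.trace_one, smul_eq_mul] at h1
    rw [← h1, ← (simple_iff_char_is_norm_one V).1 inferInstance, map_sum]
    refine Finset.sum_congr rfl fun g _ ↦ ?_
    rw [map_smul, smul_eq_mul, mul_comm]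
    rfl
  have hd : (finrank ℂ V : ℂ) ≠ 0 := by exact_mod_cast finrank_pos.ne'
  have hintegral : IsIntegral ℤ c := by
    have h1 : IsIntegral R (F a) := (Algebra.IsIntegral.isIntegral (R := R) a).map F
    have h2 : F a = algebraMap ℂ (End ℂ V) c := by rw [hc, Algebra.algebraMap_eq_smul_one]
    rw [h2] at h1
    exact isIntegral_trans (R := ℤ) (A := R) c
      ((isIntegral_algebraMap_iff (algebraMap ℂ (End ℂ V)).injective).1 h1)
  have hq : c = algebraMap ℚ ℂ (Nat.card G / finrank ℂ V) := by
    rw [eq_div_of_mul_eq hd hmul]; simp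
  rw [hq, isIntegral_algebraMap_iff (algebraMap ℚ ℂ).injective,
    IsIntegrallyClosed.isIntegral_iff] at hintegral
  obtain ⟨z, hz⟩ := hintegral
  have hd' : (finrank ℂ V : ℚ) ≠ 0 := by exact_mod_cast finrank_pos.ne'
  rw [eq_div_iff hd', eq_intCast] at hz
  rw [← Int.natCast_dvd_natCast]
  exact ⟨z, by rw [mul_comm]; exact_mod_cast hz.symm⟩

end FDRep

open Classical in
theorem Nat.div_piPart (π : Set ℕ) {n : ℕ} (hn : n ≠ 0) :
    n / Nat.piPart π n = n.factorization.prod fun p k ↦ if p ∈ π then 1 else p ^ k := by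
  have h : n = (n.factorization.prod fun p k ↦ if p ∈ π then 1 else p ^ k) * Nat.piPart π n := by
    nth_rw 1 [← Nat.prod_factorization_pow_eq_self hn]
    rw [Nat.piPart, ← Finsupp.prod_mul]
    refine Finsupp.prod_congr fun p _ ↦ ?_
    split_ifs <;> simp
  have h0 : Nat.piPart π n ≠ 0 := by
    intro h0
    rw [h0, mul_zero] at h
    exact hn h
  exact Nat.div_eq_of_eq_mul_left (Nat.pos_of_ne_zero h0) h

theorem Nat.Prime.notMem_of_dvd_div_piPart {π : Set ℕ} {n p : ℕ} (hp : p.Prime) (hn : n ≠ 0)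
    (h : p ∣ n / Nat.piPart π n) : p ∉ π := by
  classical
  rw [Nat.div_piPart π hn, Finsupp.prod, hp.prime.dvd_finsetProd_iff] at h
  obtain ⟨q, hq, hpq⟩ := h
  split_ifs at hpq with hqπ
  · exact absurd (Nat.dvd_one.1 hpq) hp.ne_one
  · rwa [(Nat.prime_dvd_prime_iff_eq hp (Nat.prime_of_mem_primeFactors hq)).1
      (hp.dvd_of_dvd_pow hpq)]

/-- If the `π`-part of `x` lies in the normal `π`-subgroup `N`, then the order of `x` modulo `N`
is coprime to the order of `N`. -/
theorem coprime_orderOf_quotient_of_elemPiPart_mem {G : Type} [Group G] [Finite G] {π : Set ℕ}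
    {N : Subgroup G} [N.Normal] (hN : IsPiNumber π (Nat.card N)) {x : G}
    (hx : elemPiPart π x ∈ N) : (orderOf (x : G ⧸ N)).Coprime (Nat.card N) := by
  refine Nat.Coprime.of_dvd_left (orderOf_dvd_of_pow_eq_one
    ((QuotientGroup.eq_one_iff (elemPiPart π x)).2 hx)) (Nat.Coprime.pow_left _ ?_)
  exact Nat.coprime_of_dvd fun p hp h1 h2 ↦
    hp.notMem_of_dvd_div_piPart (orderOf_pos x).ne' h1 (hN p hp h2)

theorem detOrder_mem {G : Type} [Group G] [Finite G] (V : FDRep ℂ G) :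
    0 < detOrder V ∧ ∀ g, LinearMap.det (V.ρ g) ^ detOrder V = 1 :=
  Nat.sInf_mem (s := {m | 0 < m ∧ ∀ g, LinearMap.det (V.ρ g) ^ m = 1})
    ⟨Nat.card G, Nat.card_pos, fun g ↦ by
      rw [← map_pow, ← map_pow, pow_card_eq_one', map_one, map_one]⟩

theorem detOrder_dvd_card {G : Type} [Group G] [Finite G] (V : FDRep ℂ G) :
    detOrder V ∣ Nat.card G := by
  obtain ⟨hpos, h⟩ := detOrder_mem V
  rw [← Nat.gcd_eq_left_iff_dvd]
  refine le_antisymm (Nat.gcd_le_left _ hpos) (Nat.sInf_le ⟨Nat.gcd_pos_of_pos_left _ hpos, ?_⟩)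
  intro g
  exact pow_gcd_eq_one.2 ⟨h g, by rw [← map_pow, ← map_pow, pow_card_eq_one', map_one, map_one]⟩

theorem exists_pow_eq_one_and_pow_eq_of_coprime {M : Type*} [CommGroup M] {m k : ℕ} {a : M}
    (hmk : k.Coprime m) (ha : a ^ m = 1) : ∃ z : M, z ^ m = 1 ∧ z ^ k = a := by
  have hbez : (1 : ℤ) = k * k.gcdA m + m * k.gcdB m := by
    rw [← Nat.gcd_eq_gcd_ab, hmk, Nat.cast_one]
  refine ⟨a ^ k.gcdA m, ?_, ?_⟩
  · rw [← zpow_natCast, zpow_comm, zpow_natCast, ha, one_zpow]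
  · rw [← zpow_natCast, ← zpow_mul, mul_comm, ← mul_one (a ^ _),
      ← one_zpow (k.gcdB m), ← ha, ← zpow_natCast a m, ← zpow_mul, ← zpow_add, ← hbez, zpow_one]

theorem FDRep.exists_extension_sup_zpowers {G : Type} [Group G] {N : Subgroup G}
    [N.Normal] [Finite N] (W : FDRep ℂ N) [CategoryTheory.Simple W] (x : G)
    (hx0 : orderOf (x : G ⧸ N) ≠ 0)
    (hx : (orderOf (x : G ⧸ N)).Coprime (Nat.card N))
    (hinv : ∀ n, W.character (MulAut.conjNormal x n) = W.character n) :
    ∃ V : FDRep ℂ ↥(N ⊔ Subgroup.zpowers x),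
      (∀ n, V.character (Subgroup.inclusion le_sup_left n) = W.character n) ∧
      detOrder V = detOrder W := by
  have := W.nontrivial_of_simple
  set m := orderOf (x : G ⧸ N) with hm
  have hxm : x ^ m ∈ N := by
    rw [← QuotientGroup.eq_one_iff, QuotientGroup.mk_pow, pow_orderOf_eq_one]
  let f : N →* (End ℂ W)ˣ := W.ρ.toHomUnits
  obtain ⟨T, hT⟩ := W.exists_linearEquiv_of_character_comp_eq (MulAut.conjNormal x) hinv
  let t₀ : (End ℂ W)ˣ := (LinearMap.GeneralLinearGroup.generalLinearEquiv ℂ W).symm T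
  have ht₀ : ∀ n, f (MulAut.conjNormal x n) = t₀ * f n * t₀⁻¹ := fun n ↦ Units.ext (hT n)
  let s : ℂˣ →* (End ℂ W)ˣ := Units.map (algebraMap ℂ (End ℂ W)).toMonoidHom
  have hs : ∀ c u, Commute (s c) u := fun c u ↦ Units.ext (Algebra.commutes _ _)
  have hdet : ∀ c, LinearMap.det (s c : End ℂ W) = (c : ℂ) ^ finrank ℂ W := by
    intro c
    change LinearMap.det (algebraMap ℂ (End ℂ W) c) = _
    rw [Algebra.algebraMap_eq_smul_one, LinearMap.det_smul, map_one, mul_one]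
  have hpow : ∀ (k : ℕ) n, f (MulAut.conjNormal (x ^ k) n) = t₀ ^ k * f n * (t₀ ^ k)⁻¹ := by
    intro k
    induction k with
    | zero => simp
    | succ k ih =>
      intro n
      rw [pow_succ, map_mul, MulAut.mul_apply, ih, ht₀]
      group
  obtain ⟨c, hc⟩ : ∃ c, t₀ ^ m = s c * f ⟨x ^ m, hxm⟩ := by
    have hcomm : ∀ n, Commute (t₀ ^ m * (f ⟨x ^ m, hxm⟩)⁻¹) (f n) := by
      intro n
      have hn : MulAut.conjNormal (x ^ m) (⟨x ^ m, hxm⟩⁻¹ * n * ⟨x ^ m, hxm⟩) = n := by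
        ext
        simp [-map_pow, MulAut.conjNormal_apply, mul_assoc]
      have h := hpow m (⟨x ^ m, hxm⟩⁻¹ * n * ⟨x ^ m, hxm⟩)
      rw [hn, map_mul, map_mul, map_inv] at h
      rw [Commute, SemiconjBy]
      nth_rw 2 [h]
      group
    obtain ⟨c, hc⟩ := W.exists_smul_one_of_commute
      (t₀ ^ m * (f ⟨x ^ m, hxm⟩)⁻¹ : (End ℂ W)ˣ) fun n ↦ (hcomm n).units_val
    have hc0 : c ≠ 0 := by
      rintro rfl
      exact Units.ne_zero _ (hc.trans (zero_smul _ _))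
    refine ⟨Units.mk0 c hc0, eq_mul_of_mul_inv_eq (Units.ext ?_)⟩
    rw [hc]
    exact (Algebra.algebraMap_eq_smul_one c).symm
  obtain ⟨z, hz⟩ : ∃ z : ℂˣ, z ^ m = c⁻¹ := by
    obtain ⟨z, hz⟩ := IsAlgClosed.exists_pow_nat_eq ((c⁻¹ : ℂˣ) : ℂ) (Nat.pos_of_ne_zero hx0)
    have hz0 : z ≠ 0 := by
      rintro rfl
      rw [zero_pow hx0] at hz
      exact (c⁻¹).ne_zero hz.symm
    exact ⟨Units.mk0 z hz0, Units.ext hz⟩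
  have htm₁ : (s z * t₀) ^ m = f ⟨x ^ m, hxm⟩ := by
    rw [(hs _ _).mul_pow, ← map_pow, hz, hc, ← mul_assoc, ← map_mul, inv_mul_cancel, map_one,
      one_mul]
  let D : (End ℂ W)ˣ →* ℂˣ := Units.map LinearMap.det
  have hDs : ∀ c, D (s c) = c ^ finrank ℂ W := fun c ↦ Units.ext (hdet c)
  set o := detOrder W
  have hDf : ∀ n, D (f n) ^ o = 1 := fun n ↦ Units.ext ((detOrder_mem W).2 n)
  obtain ⟨ζ, hζm, hζ⟩ := exists_pow_eq_one_and_pow_eq_of_coprime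
    (m := m) (k := finrank ℂ W * o) (a := (D (s z * t₀) ^ o)⁻¹)
    (Nat.Coprime.mul_left (hx.symm.of_dvd_left W.finrank_dvd_card)
      (hx.symm.of_dvd_left (detOrder_dvd_card W)))
    (by rw [inv_pow, pow_right_comm, ← map_pow, htm₁, hDf, inv_one])
  set t := s ζ * (s z * t₀) with ht
  have htm : t ^ m = f ⟨x ^ m, hxm⟩ := by
    rw [ht, (hs _ _).mul_pow, ← map_pow, hζm, map_one, one_mul, htm₁]
  have hDt : D t ^ o = 1 := by
    rw [ht, map_mul, mul_pow, hDs, ← pow_mul, hζ, inv_mul_cancel]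
  obtain ⟨F, hFf, hFt⟩ := N.exists_monoidHom_sup_zpowers x f t
    (fun n ↦ by
      rw [ht₀, ht, ← mul_assoc, ← map_mul, mul_inv_rev, mul_assoc (s _), mul_assoc (s _),
        (hs _ _).eq]
      group)
    (fun k hk ↦ by
      obtain ⟨q, rfl⟩ : (m : ℤ) ∣ k := by
        rw [hm, orderOf_dvd_iff_zpow_eq_one, ← QuotientGroup.mk_zpow, QuotientGroup.eq_one_iff]
        exact hk
      rw [zpow_mul t, zpow_natCast, htm, ← map_zpow]
      congr 1
      ext
      simp [zpow_mul])
  let V : FDRep ℂ ↥(N ⊔ Subgroup.zpowers x) := FDRep.of (V := W) ((Units.coeHom _).comp F)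
  have hV : ∀ n, V.ρ (Subgroup.inclusion le_sup_left n) = W.ρ n :=
    fun n ↦ congrArg Units.val (hFf n)
  have hVo : ∀ y, D (F y) ^ o = 1 := by
    rintro ⟨y, hy⟩
    obtain ⟨n, hn, _, ⟨k, rfl⟩, rfl⟩ := Subgroup.mem_sup_of_normal_left.1 hy
    have : (⟨n * x ^ k, hy⟩ : ↥(N ⊔ Subgroup.zpowers x)) =
      Subgroup.inclusion le_sup_left ⟨n, hn⟩ *
        ⟨x, Subgroup.mem_sup_right (Subgroup.mem_zpowers x)⟩ ^ k := by ext; simp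
    rw [this, map_mul, map_zpow, hFf, hFt, map_mul, map_zpow, mul_pow, hDf, ← zpow_natCast,
      zpow_comm, zpow_natCast, hDt, one_zpow, one_mul]
  have hVset : ∀ y, LinearMap.det (V.ρ y) ^ o = 1 := fun y ↦ congrArg Units.val (hVo y)
  refine ⟨V, fun n ↦ congrArg (LinearMap.trace ℂ W) (hV n), le_antisymm
    (Nat.sInf_le ⟨(detOrder_mem W).1, hVset⟩) ?_⟩
  have hne := Nat.sInf_mem (s := {m | 0 < m ∧ ∀ y, LinearMap.det (V.ρ y) ^ m = 1})
    ⟨o, (detOrder_mem W).1, hVset⟩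
  exact Nat.sInf_le ⟨hne.1, fun n ↦ by rw [← hV]; exact hne.2 _⟩

theorem charInner_self_eq_one_iff_simple {G : Type} [Group G] [Finite G] (V : FDRep ℂ G) :
    charInner G V.character V.character = 1 ↔ CategoryTheory.Simple V := by
  have := Fintype.ofFinite G
  rw [FDRep.simple_iff_char_is_norm_one, charInner, finsum_eq_sum_of_fintype,
    inv_mul_eq_one₀ (NeZero.ne _), eq_comm]
  simp only [FDRep.character_inv]

theorem elemPiPart_conj (π : Set ℕ) {G : Type} [Group G] (x h : G) :
    elemPiPart π (h * x * h⁻¹) = h * elemPiPart π x * h⁻¹ := by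
  have : orderOf (h * x * h⁻¹) = orderOf x := by
    simpa using (MulAut.conj h).orderOf_eq x
  simp only [elemPiPart, this, conj_pow]

theorem detOrder_of_comp {H K : Type} [Group H] [Group K] (V : FDRep ℂ H) (f : K →* H)
    (hf : Function.Surjective f) : detOrder (FDRep.of (V := V) (V.ρ.comp f)) = detOrder V := by
  unfold detOrder
  congr 1
  ext m
  exact and_congr_right fun _ ↦ hf.forall (p := fun h ↦ LinearMap.det (V.ρ h) ^ m = 1) |>.symm

theorem canonical_extension_values_are_class_function
    {G : Type} [Group G] [Finite G] (π : Set ℕ) (N : Subgroup G) [N.Normal]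
    (hNpi : IsPiNumber π (Nat.card ↥N))
    (θ : ↥N → ℂ) (hθ : IsIrrChar ↥N θ) (hinv : IsGInvariant N θ)
    (θhat : G → ℂ)
    (hdef : ∀ (g : G), elemPiPart π g ∈ N →
      ∀ φ : ↥(N ⊔ Subgroup.zpowers g) → ℂ,
        IsCanonicalExtension le_sup_left θ φ →
        θhat g = φ ⟨g, Subgroup.mem_sup_right (Subgroup.mem_zpowers g)⟩)
    (x h : G) (hx : elemPiPart π x ∈ N) :
    θhat (h * x * h⁻¹) = θhat x := by
  obtain ⟨⟨W, hW⟩, hnorm⟩ := hθ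
  obtain rfl : θ = W.character := funext hW
  have := (charInner_self_eq_one_iff_simple W).1 hnorm
  obtain ⟨V, hVW, hdet⟩ := W.exists_extension_sup_zpowers x (orderOf_pos _).ne'
    (coprime_orderOf_quotient_of_elemPiPart_mem hNpi hx) (hinv x)
  have hmap : (N ⊔ Subgroup.zpowers (h * x * h⁻¹)).map (MulAut.conj h⁻¹).toMonoidHom =
      N ⊔ Subgroup.zpowers x := by
    have hN : N.map (MulAut.conj h⁻¹).toMonoidHom = N := Subgroup.Normal.map_conj_eq N h⁻¹
    rw [Subgroup.map_sup, MonoidHom.map_zpowers, hN]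
    simp [mul_assoc]
  let e : ↥(N ⊔ Subgroup.zpowers (h * x * h⁻¹)) ≃* ↥(N ⊔ Subgroup.zpowers x) :=
    ((MulAut.conj h⁻¹).subgroupMap _).trans (MulEquiv.subgroupCongr hmap)
  rw [hdef x hx V.character ⟨hVW, V, W, fun _ ↦ rfl, fun _ ↦ rfl, hdet⟩,
    hdef (h * x * h⁻¹) (by rw [elemPiPart_conj]; exact Subgroup.Normal.conj_mem ‹_› _ hx h)
      (fun y ↦ V.character (e y))
      ⟨fun n ↦ ?_, FDRep.of (V := V) (V.ρ.comp e.toMonoidHom), W, fun _ ↦ rfl, fun _ ↦ rfl,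
        (detOrder_of_comp V _ e.surjective).trans hdet⟩]
  · congr 1
    refine Subtype.ext ?_
    change h⁻¹ * (h * x * h⁻¹) * h⁻¹⁻¹ = x
    group
  · rw [← hinv h⁻¹ n, ← hVW]
    rfl
end
end

section
/- Let G be a finite group, N ⊴ G a π-group, θ ∈ Irr(N) G-invariant, and θ̂ the class function defined by θ̂(g) = θ_g(g) when g_π ∈ N (θ_g the canonical extension of θ to N⟨g⟩) and θ̂(g) = 0 otherwise. Then θ̂(g) ≠ 0 for every π'-element g of G. -/
open scoped BigOperators
noncomputable section

/-- A finite-dimensional complex representation of a finite group is irreducible if it is nonzero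
and every endomorphism commuting with the group is a scalar. -/
theorem isIrreducible_of_commutant {G V : Type*} [Group G] [Finite G] [AddCommGroup V] [Module ℂ V]
    [Nontrivial V] (ρ : Representation ℂ G V)
    (h : ∀ f : Module.End ℂ V, (∀ g, f * ρ g = ρ g * f) → ∃ c : ℂ, f = c • 1) :
    ρ.IsIrreducible := by
  have : NeZero (Nat.card G : ℂ) := ⟨by simp [Nat.card_pos.ne']⟩
  have hnt : Nontrivial (Subrepresentation ρ) := by
    refine ⟨⟨⊥, ⊤, fun hbt => ?_⟩⟩
    obtain ⟨v, hv⟩ := exists_ne (0 : V)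
    have h1 : v ∈ (⊤ : Subrepresentation ρ).toSubmodule := Submodule.mem_top
    rw [← hbt] at h1
    exact hv ((Submodule.mem_bot ℂ).1 h1)
  refine { eq_bot_or_eq_top := fun U => ?_ }
  obtain ⟨U', hU'⟩ := exists_isCompl U
  have hc : IsCompl U.toSubmodule U'.toSubmodule := by
    refine ⟨disjoint_iff.2 ?_, codisjoint_iff.2 ?_⟩
    · rw [← Subrepresentation.toSubmodule_inf, hU'.inf_eq_bot]; rfl
    · rw [← Subrepresentation.toSubmodule_sup, hU'.sup_eq_top]; rfl
  let P := Submodule.projection _ _ hc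
  have hcomm : ∀ g, P * ρ g = ρ g * P := by
    intro g
    ext v
    obtain ⟨a, ha, b, hb, rfl⟩ := Submodule.mem_sup.1
      (hc.sup_eq_top ▸ Submodule.mem_top : v ∈ U.toSubmodule ⊔ U'.toSubmodule)
    have h1 := U.apply_mem_toSubmodule g ha
    have h2 := U'.apply_mem_toSubmodule g hb
    simp only [Module.End.mul_apply, map_add]
    simp only [P]
    rw [Submodule.projection_apply_left hc ⟨_, h1⟩, Submodule.projection_apply_left hc ⟨_, ha⟩,
      (Submodule.projection_apply_eq_zero_iff hc).2 h2,
      (Submodule.projection_apply_eq_zero_iff hc).2 hb]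
    simp
  obtain ⟨c, hc'⟩ := h _ hcomm
  by_cases hc0 : c = 0
  · left
    apply Subrepresentation.toSubmodule_injective
    refine (Submodule.eq_bot_iff _).2 fun u hu => ?_
    have := Submodule.projection_apply_left hc ⟨u, hu⟩
    rw [show Submodule.projection _ _ hc = _ from hc', hc0] at this
    simpa using this.symm
  · right
    apply Subrepresentation.toSubmodule_injective
    refine Submodule.eq_top_iff'.2 fun u => ?_
    have := Submodule.projection_apply_mem hc u
    rw [show Submodule.projection _ _ hc = _ from hc'] at this
    simpa [hc0] using (U.toSubmodule.smul_mem c⁻¹ this)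

/-- Schur's lemma. -/
theorem exists_eq_smul_one_of_commute {G V : Type*} [Group G] [AddCommGroup V] [Module ℂ V]
    [FiniteDimensional ℂ V] (ρ : Representation ℂ G V) [ρ.IsIrreducible] (f : Module.End ℂ V)
    (hf : ∀ g, f * ρ g = ρ g * f) : ∃ c : ℂ, f = c • 1 := by
  let F : Representation.IntertwiningMap ρ ρ := ⟨f, hf⟩
  obtain ⟨c, hc⟩ :=
    (Representation.IsIrreducible.algebraMap_intertwiningMap_bijective_of_isAlgClosed (ρ := ρ)).2 F
  refine ⟨c, ?_⟩
  have := congrArg (fun e => e.toLinearMap) hc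
  exact this.symm

theorem nontrivial_of_isIrreducible {G V : Type*} [Group G] [AddCommGroup V] [Module ℂ V]
    (ρ : Representation ℂ G V) [ρ.IsIrreducible] : Nontrivial V := by
  by_contra hV
  rw [not_nontrivial_iff_subsingleton] at hV
  refine (bot_ne_top : (⊥ : Subrepresentation ρ) ≠ ⊤) ?_
  exact Subrepresentation.toSubmodule_injective (Subsingleton.elim _ _)

theorem nonempty_equiv_of_character_eq {G V W : Type} [Group G] [Fintype G] [AddCommGroup V]
    [Module ℂ V] [FiniteDimensional ℂ V] [AddCommGroup W] [Module ℂ W] [FiniteDimensional ℂ W]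
    (ρ : Representation ℂ G V) (σ : Representation ℂ G W) [ρ.IsIrreducible] [σ.IsIrreducible]
    (h : ρ.character = σ.character) : Nonempty (σ.Equiv ρ) := by
  classical
  have : Invertible (Nat.card G : ℂ) := invertibleOfNonzero (by simp)
  by_contra hne
  have h1 := Representation.char_orthonormal ρ ρ
  have h2 := Representation.char_orthonormal ρ σ
  rw [if_pos ⟨Representation.Equiv.refl ρ⟩] at h1
  rw [if_neg hne, ← h, h1] at h2
  exact one_ne_zero h2

/-- The character of an irreducible finite-dimensional complex representation. -/
def IsIrreducibleCharacter {G : Type} [Group G] (χ : G → ℂ) : Prop :=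
  ∃ (V : Type) (_ : AddCommGroup V) (_ : Module ℂ V) (_ : FiniteDimensional ℂ V)
    (ρ : Representation ℂ G V), ρ.IsIrreducible ∧ χ = ρ.character

theorem IsIrreducibleCharacter.exists_apply_one_eq {G : Type} [Group G] {χ : G → ℂ}
    (h : IsIrreducibleCharacter χ) : ∃ n : ℕ, n ≠ 0 ∧ χ 1 = n := by
  obtain ⟨V, _, _, _, ρ, hρ, rfl⟩ := h
  have := nontrivial_of_isIrreducible ρ
  exact ⟨_, Module.finrank_pos.ne', ρ.char_one⟩

open Classical in
theorem IsIrreducibleCharacter.orthonormal {G : Type} [Group G] [Fintype G] {χ ψ : G → ℂ}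
    (hχ : IsIrreducibleCharacter χ) (hψ : IsIrreducibleCharacter ψ) :
    (Nat.card G : ℂ)⁻¹ * ∑ g : G, χ g * ψ g⁻¹ = if χ = ψ then 1 else 0 := by
  obtain ⟨V, _, _, _, ρ, hρ, rfl⟩ := hχ
  obtain ⟨W, _, _, _, σ, hσ, rfl⟩ := hψ
  have : Invertible (Nat.card G : ℂ) := invertibleOfNonzero (by simp)
  rw [Representation.char_orthonormal]
  by_cases h : Nonempty (σ.Equiv ρ)
  · obtain ⟨e⟩ := h
    rw [if_pos ⟨e⟩, if_pos (Representation.char_iso e).symm]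
  · rw [if_neg h, if_neg fun heq => h (nonempty_equiv_of_character_eq ρ σ heq)]

/-- Complete reducibility: `V` is a direct sum of irreducible subrepresentations, so that the
trace of every representing operator splits accordingly. -/
theorem exists_irreducible_decomposition {G : Type} [Group G] [Finite G] (V : Type)
    [AddCommGroup V] [Module ℂ V] [FiniteDimensional ℂ V] (ρ : Representation ℂ G V) :
    ∃ (ι : Type) (_ : Fintype ι) (χ : ι → G → ℂ), (∀ i, IsIrreducibleCharacter (χ i)) ∧
      ∀ g, ρ.character g = ∑ i, χ i g := by
  induction hn : Module.finrank ℂ V using Nat.strong_induction_on generalizing V with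
  | _ n ih =>
  by_cases hV : Nontrivial V
  swap
  · rw [not_nontrivial_iff_subsingleton] at hV
    refine ⟨Empty, inferInstance, fun i => i.elim, fun i => i.elim, fun g => ?_⟩
    simp [Representation.character, Subsingleton.elim (ρ g) 0]
  by_cases hirr : ρ.IsIrreducible
  · exact ⟨Unit, inferInstance, fun _ => ρ.character,
      fun _ => ⟨V, _, _, inferInstance, ρ, hirr, rfl⟩, by simp⟩
  have : NeZero (Nat.card G : ℂ) := ⟨by simp [Nat.card_pos.ne']⟩
  have hnt : Nontrivial (Subrepresentation ρ) := by
    refine ⟨⟨⊥, ⊤, fun hbt => ?_⟩⟩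
    obtain ⟨v, hv⟩ := exists_ne (0 : V)
    have h1 : v ∈ (⊤ : Subrepresentation ρ).toSubmodule := Submodule.mem_top
    rw [← hbt] at h1
    exact hv ((Submodule.mem_bot ℂ).1 h1)
  obtain ⟨U, hU⟩ : ∃ U : Subrepresentation ρ, U ≠ ⊥ ∧ U ≠ ⊤ := by
    by_contra! hcon
    exact hirr { eq_bot_or_eq_top := fun U => or_iff_not_imp_left.2 (hcon U) }
  obtain ⟨U', hU'⟩ := exists_isCompl U
  have hc : IsCompl U.toSubmodule U'.toSubmodule := by
    refine ⟨disjoint_iff.2 ?_, codisjoint_iff.2 ?_⟩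
    · rw [← Subrepresentation.toSubmodule_inf, hU'.inf_eq_bot]; rfl
    · rw [← Subrepresentation.toSubmodule_sup, hU'.sup_eq_top]; rfl
  have hsum := Submodule.finrank_add_eq_of_isCompl hc
  have hpos : 0 < Module.finrank ℂ U.toSubmodule := by
    refine Nat.pos_of_ne_zero fun h0 => hU.1 ?_
    exact Subrepresentation.toSubmodule_injective (Submodule.finrank_eq_zero.1 h0)
  have hpos' : 0 < Module.finrank ℂ U'.toSubmodule := by
    refine Nat.pos_of_ne_zero fun h0 => hU.2 ?_
    have h1 : U'.toSubmodule = ⊥ := Submodule.finrank_eq_zero.1 h0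
    rw [h1] at hc
    apply Subrepresentation.toSubmodule_injective
    exact eq_top_of_isCompl_bot hc
  obtain ⟨ι, _, χ, hχ, hχs⟩ := ih _ (by omega) U.toSubmodule U.toRepresentation rfl
  obtain ⟨ι', _, χ', hχ', hχs'⟩ := ih _ (by omega) U'.toSubmodule U'.toRepresentation rfl
  refine ⟨ι ⊕ ι', inferInstance, Sum.elim χ χ', ?_, fun g => ?_⟩
  · rintro (i | i)
    exacts [hχ i, hχ' i]
  · rw [Fintype.sum_sum_type]
    simp only [Sum.elim_inl, Sum.elim_inr, ← hχs, ← hχs']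
    let A : Bool → Submodule ℂ V := fun b => if b then U.toSubmodule else U'.toSubmodule
    have hA : DirectSum.IsInternal A :=
      (DirectSum.isInternal_submodule_iff_isCompl A (i := true) (j := false) (by simp)
        (by ext b; cases b <;> simp)).2 hc
    have hm : ∀ b, Set.MapsTo (ρ g) (A b) (A b) := by
      rintro (_ | _)
      exacts [U'.apply_mem_toSubmodule g, U.apply_mem_toSubmodule g]
    have := LinearMap.trace_eq_sum_trace_restrict hA hm
    rw [Fintype.sum_bool] at this
    exact this

/-- Simultaneous decomposition of a representation of `C` together with a commuting operator of
finite order. -/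
theorem exists_decomposition_of_commuting {C : Type} [Group C] [Finite C] (V : Type)
    [AddCommGroup V] [Module ℂ V] [FiniteDimensional ℂ V] (ρ : Representation ℂ C V)
    (T : Module.End ℂ V) {m : ℕ} (hm : 0 < m) (hT : T ^ m = 1) (hc : ∀ c, T * ρ c = ρ c * T) :
    ∃ (ι : Type) (_ : Fintype ι) (a : ι → ℂ) (χ : ι → C → ℂ), (∀ i, a i ^ m = 1) ∧
      (∀ i, IsIrreducibleCharacter (χ i)) ∧
      ∀ c (k : ℕ), LinearMap.trace ℂ V (ρ c * T ^ k) = ∑ i, a i ^ k * χ i c := by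
  let t : (Module.End ℂ V)ˣ := Units.ofPowEqOne T m hT hm.ne'
  have htm : t ^ m = 1 := Units.pow_ofPowEqOne hT hm.ne'
  have ht : (t : Module.End ℂ V) = T := rfl
  have : Finite (Subgroup.zpowers t) := by
    exact (isOfFinOrder_iff_pow_eq_one.2 ⟨m, hm, htm⟩).finite_zpowers
  let τ : Subgroup.zpowers t →* Module.End ℂ V :=
    (Units.coeHom _).comp (Subgroup.zpowers t).subtype
  have hcomm : ∀ (c : C) (z : Subgroup.zpowers t), Commute (ρ c) (τ z) := by
    rintro c ⟨z, k, rfl⟩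
    have h1 : Commute (ρ c) (t : Module.End ℂ V) := (hc c).symm
    exact h1.units_zpow_right k
  let σ : Representation ℂ (C × Subgroup.zpowers t) V := MonoidHom.noncommCoprod ρ τ hcomm
  let z : Subgroup.zpowers t := ⟨t, Subgroup.mem_zpowers t⟩
  have hz : ∀ (c : C) (k : ℕ), σ (c, z ^ k) = ρ c * T ^ k := by
    intro c k
    simp [σ, MonoidHom.noncommCoprod_apply, z, τ, ht]
  obtain ⟨ι, _, χ, hχ, hsum⟩ := exists_irreducible_decomposition V σ
  have key : ∀ i, ∃ (a : ℂ) (ψ : C → ℂ), a ^ m = 1 ∧ IsIrreducibleCharacter ψ ∧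
      ∀ c (k : ℕ), χ i (c, z ^ k) = a ^ k * ψ c := by
    intro i
    obtain ⟨W, _, _, _, κ, hκ, hχi⟩ := hχ i
    have := nontrivial_of_isIrreducible κ
    obtain ⟨a, ha⟩ := exists_eq_smul_one_of_commute κ (κ (1, z)) (by
      rintro ⟨c, y⟩
      rw [← map_mul, ← map_mul]
      congr 1
      ext
      · simp
      · obtain ⟨y, k, rfl⟩ := y
        simp [z, (Commute.refl t).zpow_right k |>.eq])
    have hk : ∀ (c : C) (k : ℕ), κ (c, z ^ k) = a ^ k • κ (c, 1) := by
      intro c k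
      have : ((c, z ^ k) : C × Subgroup.zpowers t) = (c, 1) * (1, z) ^ k := by
        ext <;> simp
      rw [this, map_mul, map_pow, ha, smul_pow, one_pow, mul_smul_comm, mul_one]
    let κ' : Representation ℂ C W := κ.comp (MonoidHom.inl C (Subgroup.zpowers t))
    refine ⟨a, κ'.character,
      ?_, ⟨W, _, _, inferInstance, _, ?_, rfl⟩, fun c k => ?_⟩
    · have h1 := hk 1 m
      have hzm : z ^ m = 1 := by ext1; simpa [z] using htm
      rw [hzm, ← Prod.one_eq_mk, map_one] at h1
      obtain ⟨w, hw⟩ := exists_ne (0 : W)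
      have h2 := congrArg (fun f => f w) h1
      simp only [Module.End.one_apply, LinearMap.smul_apply] at h2
      have h3 : (a ^ m - 1) • w = 0 := by rw [sub_smul, one_smul, ← h2, sub_self]
      exact sub_eq_zero.1 ((smul_eq_zero.1 h3).resolve_right hw)
    · refine isIrreducible_of_commutant _ fun f hf => exists_eq_smul_one_of_commute κ f ?_
      rintro ⟨c, y⟩
      obtain ⟨k, hk'⟩ : ∃ k : ℕ, z ^ k = y := by
        obtain ⟨y, hy⟩ := y
        obtain ⟨k, rfl⟩ :=
          (isOfFinOrder_iff_pow_eq_one.2 ⟨m, hm, htm⟩).mem_powers_iff_mem_zpowers.2 hy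
        exact ⟨k, by ext1; simp [z]⟩
      rw [← hk', hk, mul_smul_comm, smul_mul_assoc]
      congr 1
      exact hf c
    · rw [hχi]
      change LinearMap.trace ℂ W (κ (c, z ^ k)) = _
      rw [hk, map_smul, smul_eq_mul]
      rfl
  choose a ψ ha hψ hχψ using key
  refine ⟨ι, inferInstance, a, ψ, ha, hψ, fun c k => ?_⟩
  rw [← hz]
  exact (hsum _).trans (Finset.sum_congr rfl fun i _ => hχψ i c k)

theorem exists_character_eq_sum_pow {G V : Type} [Group G] [AddCommGroup V] [Module ℂ V]
    [FiniteDimensional ℂ V] (ρ : Representation ℂ G V) {g : G} (hg : IsOfFinOrder g) :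
    ∃ (ι : Type) (_ : Fintype ι) (a : ι → ℂ) (d : ι → ℕ), (∀ i, a i ^ orderOf g = 1) ∧
      ∀ k : ℕ, ρ.character (g ^ k) = ∑ i, a i ^ k * d i := by
  obtain ⟨ι, _, a, χ, ha, hχ, hsum⟩ := exists_decomposition_of_commuting (C := Unit) V
    (1 : Unit →* Module.End ℂ V) (ρ g) hg.orderOf_pos
    (by rw [← map_pow, pow_orderOf_eq_one, map_one]) (by simp)
  choose d _ hd using fun i => (hχ i).exists_apply_one_eq
  refine ⟨ι, inferInstance, a, d, ha, fun k => ?_⟩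
  have := hsum 1 k
  simp only [hd] at this
  rw [← this]
  simp [Representation.character]

theorem character_inv_eq_conj {G V : Type} [Group G] [AddCommGroup V] [Module ℂ V]
    [FiniteDimensional ℂ V] (ρ : Representation ℂ G V) {g : G} (hg : IsOfFinOrder g) :
    ρ.character g⁻¹ = starRingEnd ℂ (ρ.character g) := by
  obtain ⟨ι, _, a, d, ha, hsum⟩ := exists_character_eq_sum_pow ρ hg
  have hpos := hg.orderOf_pos
  have h1 : g⁻¹ = g ^ (orderOf g - 1) := by
    rw [inv_eq_iff_mul_eq_one, ← pow_succ', Nat.sub_add_cancel hpos, pow_orderOf_eq_one]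
  have h2 := hsum 1
  rw [pow_one] at h2
  rw [h1, hsum, h2, map_sum]
  refine Finset.sum_congr rfl fun i _ => ?_
  have hn : ‖a i‖ = 1 := Complex.norm_eq_one_of_pow_eq_one (ha i) hpos.ne'
  have h3 : a i ^ (orderOf g - 1) = (a i)⁻¹ := by
    refine eq_inv_of_mul_eq_one_left ?_
    rw [← pow_succ, Nat.sub_add_cancel hpos, ha]
  rw [h3, Complex.inv_eq_conj hn]
  simp

theorem isIntegral_character {G V : Type} [Group G] [AddCommGroup V] [Module ℂ V]
    [FiniteDimensional ℂ V] (ρ : Representation ℂ G V) {g : G} (hg : IsOfFinOrder g) :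
    IsIntegral ℤ (ρ.character g) := by
  obtain ⟨ι, _, a, d, ha, hsum⟩ := exists_character_eq_sum_pow ρ hg
  have h2 := hsum 1
  rw [pow_one] at h2
  rw [h2]
  refine IsIntegral.sum _ fun i _ => IsIntegral.mul ?_ (isIntegral_natCast _)
  exact IsIntegral.pow (.of_pow hg.orderOf_pos (by rw [ha]; exact isIntegral_one)) 1

section Schur

variable {G V : Type} [Group G] [Fintype G] [AddCommGroup V] [Module ℂ V]
    [FiniteDimensional ℂ V] (ρ : Representation ℂ G V) [ρ.IsIrreducible]

theorem finrank_smul_sum_conj (X : Module.End ℂ V) :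
    (Module.finrank ℂ V : ℂ) • ∑ g, ρ g * X * ρ g⁻¹ =
      ((Nat.card G : ℂ) * LinearMap.trace ℂ V X) • (1 : Module.End ℂ V) := by
  obtain ⟨c, hc⟩ := exists_eq_smul_one_of_commute ρ (∑ g, ρ g * X * ρ g⁻¹) (by
    intro h
    rw [Finset.sum_mul, Finset.mul_sum]
    refine Fintype.sum_equiv (Equiv.mulLeft h⁻¹) _ _ fun g => ?_
    simp only [Equiv.coe_mulLeft, mul_inv_rev, inv_inv, map_mul, ← mul_assoc]
    rw [← map_mul ρ h h⁻¹, mul_inv_cancel, map_one, one_mul])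
  have h1 := congrArg (LinearMap.trace ℂ V) hc
  have h2 : ∀ g, LinearMap.trace ℂ V (ρ g * X * ρ g⁻¹) = LinearMap.trace ℂ V X := by
    intro g
    rw [LinearMap.trace_mul_comm, ← mul_assoc, ← map_mul, inv_mul_cancel, map_one, one_mul]
  rw [map_sum, Finset.sum_congr rfl fun g _ => h2 g, map_smul, LinearMap.trace_one,
    Finset.sum_const, Finset.card_univ, ← Nat.card_eq_fintype_card, nsmul_eq_mul,
    smul_eq_mul] at h1
  rw [hc, h1, smul_smul, mul_comm]

/-- Schur orthogonality in coordinate-free form. -/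
theorem finrank_mul_sum_trace_mul_trace (A B : Module.End ℂ V) :
    (Module.finrank ℂ V : ℂ) *
        ∑ g, LinearMap.trace ℂ V (A * ρ g) * LinearMap.trace ℂ V (ρ g⁻¹ * B) =
      Nat.card G * LinearMap.trace ℂ V (A * B) := by
  classical
  let b := Module.finBasis ℂ V
  have htr : ∀ P : Module.End ℂ V, LinearMap.trace ℂ V P = ∑ i, b.coord i (P (b i)) := by
    intro P
    rw [LinearMap.trace_eq_matrix_trace ℂ b, Matrix.trace]
    simp [LinearMap.toMatrix_apply]
  let E : Fin (Module.finrank ℂ V) → Fin (Module.finrank ℂ V) → Module.End ℂ V :=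
    fun i j => (b.coord j).smulRight (b i)
  have hE : ∀ i j, LinearMap.trace ℂ V (E i j) = if i = j then 1 else 0 := by
    intro i j
    rw [htr, Finset.sum_eq_single j]
    · simp [E, Finsupp.single_apply]
    · intro k _ hk
      simp [E, hk]
    · simp
  have hPQ : ∀ P Q : Module.End ℂ V, LinearMap.trace ℂ V P * LinearMap.trace ℂ V Q =
      ∑ i, ∑ j, b.coord i ((P * E i j * Q) (b j)) := by
    intro P Q
    rw [htr, htr, Finset.sum_mul_sum]
    refine Finset.sum_congr rfl fun i _ => Finset.sum_congr rfl fun j _ => ?_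
    simp [E, mul_comm]
  have hS : ∀ i j, (Module.finrank ℂ V : ℂ) •
      ∑ g, (A * ρ g) * E i j * (ρ g⁻¹ * B) =
        ((Nat.card G : ℂ) * if i = j then 1 else 0) • (A * B) := by
    intro i j
    have h1 := congrArg (fun X => A * X * B) (finrank_smul_sum_conj ρ (E i j))
    simp only [hE, mul_smul_comm, smul_mul_assoc, mul_one, Finset.mul_sum, Finset.sum_mul] at h1
    rw [← h1]
    simp only [mul_assoc]
  calc _ = ∑ i, ∑ j, b.coord i (((Module.finrank ℂ V : ℂ) •
        ∑ g, (A * ρ g) * E i j * (ρ g⁻¹ * B)) (b j)) := by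
        simp only [hPQ, LinearMap.smul_apply, map_smul, LinearMap.sum_apply, map_sum, smul_eq_mul,
          ← Finset.mul_sum]
        rw [Finset.sum_comm]
        congr 1
        exact Finset.sum_congr rfl fun i _ => Finset.sum_comm
    _ = _ := by
        simp only [hS, LinearMap.smul_apply, map_smul, smul_eq_mul, mul_ite, mul_one, mul_zero,
          ite_mul, zero_mul, Finset.sum_ite_eq, Finset.mem_univ, if_true, ← Finset.mul_sum]
        rw [htr]

end Schur

/-- The degree of an irreducible representation divides the order of the group. -/
theorem finrank_dvd_card_of_isIrreducible {G V : Type} [Group G] [Fintype G] [AddCommGroup V]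
    [Module ℂ V] [FiniteDimensional ℂ V] (ρ : Representation ℂ G V) [ρ.IsIrreducible] :
    Module.finrank ℂ V ∣ Nat.card G := by
  have := nontrivial_of_isIrreducible ρ
  have hd : (Module.finrank ℂ V : ℂ) ≠ 0 := by exact_mod_cast Module.finrank_pos.ne'
  set u : ℂ := (Nat.card G : ℂ) / Module.finrank ℂ V with hu
  have hconv : ∀ n l : G,
      ∑ k, ρ.character (k⁻¹ * l) * ρ.character (n⁻¹ * k) = u * ρ.character (n⁻¹ * l) := by
    intro n l
    have h1 := finrank_mul_sum_trace_mul_trace ρ 1 (ρ (n⁻¹ * l))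
    rw [hu, div_mul_eq_mul_div, eq_div_iff hd, mul_comm]
    simp only [one_mul, ← map_mul] at h1
    refine Eq.trans ?_ h1
    congr 1
    refine Fintype.sum_equiv (Equiv.mulLeft n⁻¹) _ _ fun k => ?_
    rw [mul_comm]
    simp [Representation.character, mul_assoc]
  let S := integralClosure ℤ ℂ
  let w : G → G → ℂ := fun l n => ρ.character (n⁻¹ * l)
  let M : Submodule S (G → ℂ) := Submodule.span S (Set.range w)
  have hint : IsIntegral S u := by
    refine isIntegral_of_smul_mem_submodule M ?_ (Submodule.fg_span (Set.finite_range w)) u ?_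
    · intro hM
      have h0 : w 1 = 0 := (Submodule.mem_bot S).1 (hM ▸ Submodule.subset_span ⟨1, rfl⟩)
      have := congrFun h0 1
      simp [w] at this
      exact Module.finrank_pos.ne' this
    · intro x hx
      induction hx using Submodule.span_induction with
      | mem x hx =>
        obtain ⟨l, rfl⟩ := hx
        have : u • w l =
            ∑ k, (⟨ρ.character (k⁻¹ * l), isIntegral_character ρ (isOfFinOrder_of_finite _)⟩ : S) •
              w k := by
          ext n
          rw [Finset.sum_apply]
          exact (hconv n l).symm
        rw [this]
        exact M.sum_mem fun k _ => M.smul_mem _ (Submodule.subset_span ⟨k, rfl⟩)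
      | zero => simp
      | add x y _ _ hx hy => rw [smul_add]; exact M.add_mem hx hy
      | smul a x _ hx => rw [smul_comm]; exact M.smul_mem _ hx
  have hint' : IsIntegral ℤ u := isIntegral_trans u hint
  have hq : u = algebraMap ℚ ℂ ((Nat.card G : ℚ) / Module.finrank ℂ V) := by simp [hu]
  rw [hq, isIntegral_algebraMap_iff (algebraMap ℚ ℂ).injective] at hint'
  obtain ⟨z, hz⟩ := IsIntegrallyClosed.isIntegral_iff.1 hint'
  have hd' : (Module.finrank ℂ V : ℚ) ≠ 0 := by exact_mod_cast Module.finrank_pos.ne'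
  rw [eq_div_iff hd', eq_intCast] at hz
  have : (Module.finrank ℂ V : ℤ) ∣ Nat.card G := ⟨z, by
    rw [mul_comm]
    exact_mod_cast hz.symm⟩
  exact_mod_cast this

/-- A nonzero algebraic integer has a complex conjugate of absolute value at least one. -/
theorem exists_embedding_one_le_norm {K : Type*} [Field K] [NumberField K] {x : K}
    (hx : IsIntegral ℤ x) (h0 : x ≠ 0) : ∃ σ : K →ₐ[ℚ] ℂ, 1 ≤ ‖σ x‖ := by
  by_contra! hlt
  have hnorm := Algebra.norm_eq_prod_embeddings ℚ ℂ x
  obtain ⟨z, hz⟩ := IsIntegrallyClosed.isIntegral_iff.1 (Algebra.isIntegral_norm ℚ hx)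
  have hz0 : z ≠ 0 := by
    rintro rfl
    simp at hz
    exact h0 (Algebra.norm_eq_zero_iff.1 hz.symm)
  have h1 : ‖algebraMap ℚ ℂ (Algebra.norm ℚ x)‖ < 1 := by
    rw [hnorm, norm_prod]
    have : Nonempty (K →ₐ[ℚ] ℂ) := ⟨IsAlgClosed.lift⟩
    calc ∏ σ : K →ₐ[ℚ] ℂ, ‖σ x‖ < ∏ _σ : K →ₐ[ℚ] ℂ, (1 : ℝ) :=
          Finset.prod_lt_prod_of_nonempty
            (fun σ _ => norm_pos_iff.2 ((map_ne_zero_iff σ σ.injective).2 h0))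
            (fun σ _ => hlt σ) Finset.univ_nonempty
      _ = 1 := by simp
  rw [← hz] at h1
  have h2 : (1 : ℝ) ≤ |(z : ℝ)| := by exact_mod_cast Int.one_le_abs hz0
  have h3 : ‖algebraMap ℚ ℂ (algebraMap ℤ ℚ z)‖ = |(z : ℝ)| := by simp
  linarith

theorem double_sum_eq_sum_fiber_mul {ι κ R : Type*} [Fintype ι] [DecidableEq κ] [CommRing R]
    (f : ι → κ) (a b : ι → R) :
    ∑ i, ∑ j, (if f i = f j then a i * b j else 0) =
      ∑ k ∈ Finset.univ.image f,
        (∑ i with f i = k, a i) * ∑ i with f i = k, b i := by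
  rw [← Finset.sum_fiberwise_of_maps_to (s := Finset.univ) (t := Finset.univ.image f) (g := f)
    (fun i _ => Finset.mem_image_of_mem f (Finset.mem_univ i))]
  refine Finset.sum_congr rfl fun k _ => ?_
  rw [Finset.sum_mul]
  refine Finset.sum_congr rfl fun i hi => ?_
  rw [Finset.mul_sum, Finset.sum_filter]
  rw [Finset.mem_filter] at hi
  refine Finset.sum_congr rfl fun j _ => ?_
  simp only [hi.2, eq_comm]

/-- If finitely many sums of `m`-th roots of unity have squared absolute values adding up to one,
then exactly one of them is nonzero. -/
theorem exists_unique_fiber_sum_ne_zero {ι κ : Type*} [Fintype ι] [DecidableEq κ] {m : ℕ}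
    (hm : 0 < m) (f : ι → κ) (a : ι → ℂ) (ha : ∀ i, a i ^ m = 1)
    (h : ∑ i, ∑ j, (if f i = f j then a i * (a j)⁻¹ else 0) = 1) :
    ∃ k, ∑ i with f i = k, a i ≠ 0 ∧ ∀ l, l ≠ k → ∑ i with f i = l, a i = 0 := by
  have : NeZero m := ⟨hm.ne'⟩
  let φ : CyclotomicField m ℚ →ₐ[ℚ] ℂ := IsAlgClosed.lift
  obtain ⟨ζ, hζ⟩ : ∃ ζ : CyclotomicField m ℚ, IsPrimitiveRoot ζ m :=
    ⟨_, @IsCyclotomicExtension.zeta_spec m _ ℚ (CyclotomicField m ℚ) _ _ _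
      (CyclotomicField.isCyclotomicExtension m ℚ)⟩
  have hω := hζ.map_of_injective φ.injective
  choose e _ he using fun i => hω.eq_pow_of_pow_eq_one (ha i)
  let z : ι → CyclotomicField m ℚ := fun i => ζ ^ e i
  have hφ : ∀ i, φ (z i) = a i := fun i => (map_pow φ _ _).trans (he i)
  have hzm : ∀ i, z i ^ m = 1 := fun i => by
    rw [← pow_mul, mul_comm, pow_mul, hζ.pow_eq_one, one_pow]
  have hK : ∑ i, ∑ j, (if f i = f j then z i * (z j)⁻¹ else 0) = 1 := by
    apply φ.injective
    rw [map_one, ← h, map_sum]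
    refine Finset.sum_congr rfl fun i _ => ?_
    rw [map_sum]
    refine Finset.sum_congr rfl fun j _ => ?_
    split_ifs <;> simp [hφ]
  let A : κ → CyclotomicField m ℚ := fun k => ∑ i with f i = k, z i
  have hA : ∀ k, φ (A k) = ∑ i with f i = k, a i := fun k => by simp [A, hφ]
  have hσ : ∀ σ : CyclotomicField m ℚ →ₐ[ℚ] ℂ, ∑ k ∈ Finset.univ.image f, ‖σ (A k)‖ ^ 2 = 1 := by
    intro σ
    have hconj : ∀ i, σ (z i)⁻¹ = starRingEnd ℂ (σ (z i)) := fun i => by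
      rw [map_inv₀, Complex.inv_eq_conj]
      exact Complex.norm_eq_one_of_pow_eq_one (by rw [← map_pow, hzm, map_one]) hm.ne'
    have h1 := congrArg σ (double_sum_eq_sum_fiber_mul f z fun i => (z i)⁻¹)
    rw [hK, map_one, map_sum] at h1
    have h2 : (1 : ℂ) = ((∑ k ∈ Finset.univ.image f, ‖σ (A k)‖ ^ 2 : ℝ) : ℂ) := by
      rw [h1]
      push_cast
      refine Finset.sum_congr rfl fun k _ => ?_
      rw [map_mul, map_sum σ (fun i => (z i)⁻¹)]
      simp only [hconj]
      rw [← map_sum (starRingEnd ℂ), ← map_sum, Complex.mul_conj, Complex.normSq_eq_norm_sq]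
      push_cast
      rfl
    exact_mod_cast h2.symm
  have hsupp : ∀ k, A k ≠ 0 → k ∈ Finset.univ.image f := by
    intro k hk
    obtain ⟨i, hi, -⟩ := Finset.exists_ne_zero_of_sum_ne_zero hk
    exact Finset.mem_image.2 ⟨i, Finset.mem_univ _, (Finset.mem_filter.1 hi).2⟩
  obtain ⟨k, hk⟩ : ∃ k, A k ≠ 0 := by
    by_contra! hall
    have := hσ φ
    simp [hall] at this
  refine ⟨k, by rw [← hA]; exact (map_ne_zero_iff φ φ.injective).2 hk, fun l hl => ?_⟩
  rw [← hA, map_eq_zero_iff φ φ.injective]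
  by_contra hl0
  obtain ⟨σ, h1⟩ := exists_embedding_one_le_norm
    (x := A k) (IsIntegral.sum _ fun i _ => .of_pow hm (by rw [hzm]; exact isIntegral_one)) hk
  have h2 : ‖σ (A k)‖ ^ 2 + ‖σ (A l)‖ ^ 2 ≤ 1 := by
    rw [← hσ σ, ← Finset.sum_pair (f := fun k => ‖σ (A k)‖ ^ 2) hl.symm]
    refine Finset.sum_le_sum_of_subset_of_nonneg ?_ fun _ _ _ => by positivity
    intro x hx
    rcases Finset.mem_insert.1 hx with rfl | hx
    · exact hsupp _ hk
    · rw [Finset.mem_singleton.1 hx]; exact hsupp _ hl0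
  have h3 : 0 < ‖σ (A l)‖ := norm_pos_iff.2 ((map_ne_zero_iff σ σ.injective).2 hl0)
  nlinarith

/-- Coprime orders: every element of the coset `N g` is `N`-conjugate to an element `c g` with
`c ∈ C_N(g)`, in a uniform way. -/
theorem card_mul_sum_coset_eq {G : Type*} [Group G] [Finite G] (N : Subgroup G) [N.Normal]
    [Fintype N] {g : G} (hcop : (Nat.card N).Coprime (orderOf g))
    (C : Subgroup N) [Fintype C] (hmemC : ∀ c : N, c ∈ C ↔ (c : G) * g = g * c) (F : N → ℂ)
    (hF : ∀ n c : N, c ∈ C → F (n * c * MulAut.conjNormal g n⁻¹) = F c) :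
    (Nat.card C : ℂ) * ∑ n, F n = Nat.card N * ∑ c : C, F c := by
  classical
  let Φ : (N ⧸ C) × C → N := fun p => p.1.out * p.2 * MulAut.conjNormal g p.1.out⁻¹
  have hΦ : ∀ p, (Φ p : G) * g = p.1.out * ((p.2 : N) * g) * (p.1.out : G)⁻¹ := by
    intro p
    simp [Φ, mul_assoc]
  obtain ⟨k, hk0, hk1⟩ := Nat.chineseRemainder hcop 0 1
  have hgk : g ^ k = g := by
    conv_rhs => rw [← pow_one g]
    exact pow_eq_pow_iff_modEq.2 hk1
  have hpow : ∀ p, ((Φ p : G) * g) ^ k = p.1.out * g * (p.1.out : G)⁻¹ := by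
    intro p
    have hc : ((p.2 : N) : G) ^ k = 1 := by
      have : (p.2 : N) ^ k = 1 := by
        rw [← orderOf_dvd_iff_pow_eq_one]
        exact (orderOf_dvd_natCard _).trans ((Nat.modEq_zero_iff_dvd).1 hk0)
      rw [← Subgroup.coe_pow, this, Subgroup.coe_one]
    have hcomm : Commute ((p.2 : N) : G) g := (hmemC _).1 p.2.2
    rw [hΦ, conj_pow, hcomm.mul_pow, hc, hgk, one_mul]
  have hinj : Function.Injective Φ := by
    rintro ⟨q, c⟩ ⟨q', c'⟩ h
    have h1 := hpow (q, c)
    rw [h, hpow] at h1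
    have hq : q = q' := by
      rw [← q.out_eq, ← q'.out_eq]
      refine QuotientGroup.eq.2 ((hmemC _).2 ?_)
      simp only at h1
      have h2 : (q'.out : G) * g = q.out * g * (q.out : G)⁻¹ * q'.out := by rw [← h1]; group
      push_cast
      rw [mul_assoc, h2]
      group
    subst hq
    simp only [Φ, mul_left_inj, mul_right_inj, Subtype.coe_inj] at h
    rw [h]
  have hcard := Subgroup.card_eq_card_quotient_mul_card_subgroup C
  have hbij : Function.Bijective Φ := by
    refine hinj.bijective_of_nat_card_le ?_
    rw [Nat.card_prod, hcard]
  have hsum : ∑ n, F n = (Nat.card (N ⧸ C) : ℂ) * ∑ c : C, F c := by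
    rw [← hbij.sum_comp, Fintype.sum_prod_type]
    simp only [Φ]
    rw [Finset.sum_congr rfl fun q _ => Finset.sum_congr rfl fun (c : C) _ => hF q.out c c.2]
    simp
  rw [hsum, hcard]
  push_cast
  ring

/-- An operator of order coprime to `|N|` that implements the action of `g` on an irreducible
representation of the normal subgroup `N` has nonzero trace. -/
theorem trace_ne_zero_of_conj_intertwining {G V : Type} [Group G] [Finite G] (N : Subgroup G)
    [N.Normal] [AddCommGroup V] [Module ℂ V] [FiniteDimensional ℂ V]
    (ρ : Representation ℂ N V) [ρ.IsIrreducible] {g : G}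
    (hcop : (Nat.card N).Coprime (orderOf g)) (T : Module.End ℂ V) (hT : T ^ orderOf g = 1)
    (hconj : ∀ n, T * ρ n = ρ (MulAut.conjNormal g n) * T) :
    LinearMap.trace ℂ V T ≠ 0 := by
  classical
  have := Fintype.ofFinite N
  have := nontrivial_of_isIrreducible ρ
  have hm : 0 < orderOf g := orderOf_pos g
  set m := orderOf g
  let S := T ^ (m - 1)
  have hST : S * T = 1 := by rw [← hT, ← pow_succ, Nat.sub_add_cancel hm]
  have hTS : T * S = 1 := by rw [← hT, ← pow_succ', Nat.sub_add_cancel hm]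
  have hS : ∀ n, ρ n * S = S * ρ (MulAut.conjNormal g n) := fun n => by
    calc ρ n * S = S * (T * ρ n) * S := by rw [← mul_assoc, hST, one_mul]
      _ = S * ρ (MulAut.conjNormal g n) := by
        rw [hconj, mul_assoc, mul_assoc, hTS, mul_one]
  let C : Subgroup N := (Subgroup.centralizer {g}).subgroupOf N
  have hC : ∀ c : N, c ∈ C ↔ (c : G) * g = g * c := fun c => by
    simp [C, Subgroup.mem_subgroupOf, Subgroup.mem_centralizer_iff, eq_comm]
  have hfix : ∀ c : C, MulAut.conjNormal g (c : N) = c := fun c => by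
    ext
    rw [MulAut.conjNormal_apply, ← (hC c).1 c.2, mul_inv_cancel_right]
  let F : N → ℂ := fun n => LinearMap.trace ℂ V (T * ρ n) * LinearMap.trace ℂ V (ρ n⁻¹ * S)
  have hF : ∀ n c : N, c ∈ C → F (n * c * MulAut.conjNormal g n⁻¹) = F c := by
    intro n c _
    have h1 : LinearMap.trace ℂ V (T * ρ (n * c * MulAut.conjNormal g n⁻¹)) =
        LinearMap.trace ℂ V (T * ρ c) := by
      calc LinearMap.trace ℂ V (T * ρ (n * c * MulAut.conjNormal g n⁻¹))
          = LinearMap.trace ℂ V (T * ρ (n * c) * ρ (MulAut.conjNormal g n⁻¹)) := by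
            rw [map_mul ρ (n * c), mul_assoc]
        _ = LinearMap.trace ℂ V (T * ρ n⁻¹ * ρ (n * c)) := by
            rw [LinearMap.trace_mul_comm, ← mul_assoc, hconj]
        _ = LinearMap.trace ℂ V (T * ρ c) := by
            rw [mul_assoc, ← map_mul ρ, inv_mul_cancel_left]
    have h2 : LinearMap.trace ℂ V (ρ (n * c * MulAut.conjNormal g n⁻¹)⁻¹ * S) =
        LinearMap.trace ℂ V (ρ c⁻¹ * S) := by
      calc LinearMap.trace ℂ V (ρ (n * c * MulAut.conjNormal g n⁻¹)⁻¹ * S)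
          = LinearMap.trace ℂ V (ρ (MulAut.conjNormal g n) * (ρ (c⁻¹ * n⁻¹) * S)) := by
            rw [← mul_assoc, ← map_mul ρ, map_inv (MulAut.conjNormal g), mul_inv_rev, inv_inv,
              mul_inv_rev]
        _ = LinearMap.trace ℂ V (ρ (c⁻¹ * n⁻¹) * (ρ n * S)) := by
            rw [LinearMap.trace_mul_comm, mul_assoc, hS]
        _ = LinearMap.trace ℂ V (ρ c⁻¹ * S) := by
            rw [← mul_assoc, ← map_mul ρ, inv_mul_cancel_right]
    simp only [F, h1, h2]
  have hsum : ∑ n, F n = Nat.card N := by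
    have h := finrank_mul_sum_trace_mul_trace ρ T S
    rw [hTS, LinearMap.trace_one, mul_comm] at h
    exact mul_right_cancel₀ (Nat.cast_ne_zero.2 Module.finrank_pos.ne') h
  have hcoset := card_mul_sum_coset_eq N hcop C hC F hF
  obtain ⟨ι, _, a, χ, ha, hχ, htr⟩ := exists_decomposition_of_commuting V (ρ.comp C.subtype) T hm hT
    fun c => (hconj c).trans (by rw [hfix]; rfl)
  have hFC : ∀ c : C, F c = ∑ i, ∑ j, a i * (a j)⁻¹ * (χ i c * χ j c⁻¹) := fun c => by
    have h1 : LinearMap.trace ℂ V (T * ρ c) = ∑ i, a i * χ i c := by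
      rw [LinearMap.trace_mul_comm]
      simpa using htr c 1
    have h2 : LinearMap.trace ℂ V (ρ (c : N)⁻¹ * S) = ∑ i, (a i)⁻¹ * χ i c⁻¹ := by
      refine (htr c⁻¹ (m - 1)).trans (Finset.sum_congr rfl fun i _ => ?_)
      congr 1
      exact eq_inv_of_mul_eq_one_left (by rw [← pow_succ, Nat.sub_add_cancel hm, ha])
    simp only [F, h1, h2, Finset.sum_mul_sum]
    exact Finset.sum_congr rfl fun i _ => Finset.sum_congr rfl fun j _ => by ring
  have hone : ∑ i, ∑ j, (if χ i = χ j then a i * (a j)⁻¹ else 0) = 1 := by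
    have hN : (Nat.card N : ℂ) ≠ 0 := Nat.cast_ne_zero.2 Nat.card_pos.ne'
    have hC0 : (Nat.card C : ℂ) ≠ 0 := Nat.cast_ne_zero.2 Nat.card_pos.ne'
    have h1 : (Nat.card C : ℂ)⁻¹ * ∑ c : C, F c = 1 := by
      rw [hsum, mul_comm] at hcoset
      rw [← mul_left_cancel₀ hN hcoset, inv_mul_cancel₀ hC0]
    rw [← h1]
    simp only [hFC]
    rw [Finset.sum_comm (s := (Finset.univ : Finset C)), Finset.mul_sum]
    refine Finset.sum_congr rfl fun i _ => ?_
    rw [Finset.sum_comm (s := (Finset.univ : Finset C)), Finset.mul_sum]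
    refine Finset.sum_congr rfl fun j _ => ?_
    rw [← Finset.mul_sum, mul_left_comm, (hχ i).orthonormal (hχ j)]
    simp
  obtain ⟨k, hk, hk'⟩ := exists_unique_fiber_sum_ne_zero hm χ a ha hone
  have hT1 : LinearMap.trace ℂ V T = (∑ i with χ i = k, a i) * k 1 := by
    have h := htr 1 1
    simp only [map_one, one_mul, pow_one] at h
    rw [h, ← Finset.sum_fiberwise_of_maps_to (t := Finset.univ.image χ) (g := χ)
      (fun i _ => Finset.mem_image_of_mem _ (Finset.mem_univ i))]
    have hfib : ∀ l, ∑ i with χ i = l, a i * χ i 1 = (∑ i with χ i = l, a i) * l 1 := fun l => by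
      rw [Finset.sum_mul]
      refine Finset.sum_congr rfl fun i hi => ?_
      rw [(Finset.mem_filter.1 hi).2]
    simp only [hfib]
    refine Finset.sum_eq_single k (fun l _ hl => by rw [hk' l hl, zero_mul]) fun hkn => ?_
    rw [Finset.sum_eq_zero, zero_mul]
    intro i hi
    exact absurd (Finset.mem_image.2 ⟨i, Finset.mem_univ i, (Finset.mem_filter.1 hi).2⟩) hkn
  obtain ⟨i, hi⟩ := Finset.nonempty_of_sum_ne_zero hk
  obtain ⟨n, hn, hk1⟩ := (hχ i).exists_apply_one_eq
  rw [(Finset.mem_filter.1 hi).2] at hk1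
  rw [hT1, hk1]
  exact mul_ne_zero hk (Nat.cast_ne_zero.2 hn)

/-- A complex representation whose character has norm one is irreducible. -/
theorem isIrreducible_of_sum_character_mul_inv {G V : Type} [Group G] [Fintype G] [AddCommGroup V]
    [Module ℂ V] [FiniteDimensional ℂ V] (ρ : Representation ℂ G V)
    (h : (Nat.card G : ℂ)⁻¹ * ∑ g : G, ρ.character g * ρ.character g⁻¹ = 1) :
    ρ.IsIrreducible := by
  have : Invertible (Nat.card G : ℂ) := invertibleOfNonzero (by simp)
  rw [Representation.card_inv_mul_sum_char_mul_char_eq_finrank, Nat.cast_eq_one] at h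
  have : Nontrivial V := by
    by_contra hV
    rw [not_nontrivial_iff_subsingleton] at hV
    have : Subsingleton (Representation.IntertwiningMap ρ ρ) :=
      ⟨fun a b => Representation.IntertwiningMap.ext (by ext; exact Subsingleton.elim _ _)⟩
    rw [Module.finrank_zero_of_subsingleton] at h
    exact zero_ne_one h
  refine isIrreducible_of_commutant ρ fun f hf => ?_
  let I : Representation.IntertwiningMap ρ ρ := ⟨LinearMap.id, fun _ => rfl⟩
  let F : Representation.IntertwiningMap ρ ρ := ⟨f, hf⟩
  have hI : I ≠ 0 := fun h0 => by
    obtain ⟨v, hv⟩ := exists_ne (0 : V)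
    exact hv (congrArg (fun e => e.toLinearMap v) h0)
  obtain ⟨c, hc⟩ := (finrank_eq_one_iff_of_nonzero' I hI).1 h F
  exact ⟨c, (congrArg (fun e => e.toLinearMap) hc).symm⟩

/-- An invariant irreducible representation of a normal subgroup `N` is implemented, for `g` of
order coprime to `|N|`, by an operator of determinant one whose order divides that of `g`. -/
theorem exists_conj_intertwining {G V : Type} [Group G] [Finite G] (N : Subgroup G) [N.Normal]
    [AddCommGroup V] [Module ℂ V] [FiniteDimensional ℂ V] (ρ : Representation ℂ N V)
    [ρ.IsIrreducible] {g : G} (hcop : (Nat.card N).Coprime (orderOf g))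
    (hinv : ∀ n, ρ.character (MulAut.conjNormal g n) = ρ.character n) :
    ∃ T : Module.End ℂ V, T ^ orderOf g = 1 ∧ LinearMap.det T = 1 ∧
      ∀ n, T * ρ n = ρ (MulAut.conjNormal g n) * T := by
  have := Fintype.ofFinite N
  have := nontrivial_of_isIrreducible ρ
  have hm : 0 < orderOf g := orderOf_pos g
  have hd : 0 < Module.finrank ℂ V := Module.finrank_pos
  let σ : Representation ℂ N V := ρ.comp (MulAut.conjNormal g).toMonoidHom
  have : σ.IsIrreducible := isIrreducible_of_commutant σ fun f hf =>
    exists_eq_smul_one_of_commute ρ f fun n => by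
      simpa [σ] using hf ((MulAut.conjNormal g).symm n)
  obtain ⟨e⟩ := nonempty_equiv_of_character_eq σ ρ (funext hinv)
  let T : Module.End ℂ V := e.toLinearEquiv.toLinearMap
  have hT : ∀ n, T * ρ n = ρ (MulAut.conjNormal g n) * T := e.toIntertwiningMap.isIntertwining'
  have hTk : ∀ (k : ℕ) n, T ^ k * ρ n = ρ (MulAut.conjNormal (g ^ k) n) * T ^ k := by
    intro k
    induction k with
    | zero => intro n; simp
    | succ k ih =>
      intro n
      rw [pow_succ, mul_assoc, hT, ← mul_assoc, ih, mul_assoc, pow_succ g, map_mul]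
      rfl
  obtain ⟨c, hc⟩ := exists_eq_smul_one_of_commute ρ (T ^ orderOf g) fun n => by
    rw [hTk, pow_orderOf_eq_one, map_one]; rfl
  have hdetT : LinearMap.det T ≠ 0 := e.toLinearEquiv.isUnit_det'.ne_zero
  have hc0 : c ≠ 0 := by
    rintro rfl
    have := congrArg LinearMap.det hc
    rw [map_pow, zero_smul, LinearMap.det_zero, zero_pow hd.ne'] at this
    exact pow_ne_zero _ hdetT this
  obtain ⟨r, hr⟩ := IsAlgClosed.exists_pow_nat_eq c⁻¹ hm
  have hrT : (r • T) ^ orderOf g = 1 := by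
    rw [smul_pow, hr, hc, smul_smul, inv_mul_cancel₀ hc0, one_smul]
  set D := LinearMap.det (r • T) with hD
  have hDm : D ^ orderOf g = 1 := by rw [hD, ← map_pow, hrT, map_one]
  have hD0 : D ≠ 0 := fun h => by rw [h, zero_pow hm.ne'] at hDm; exact zero_ne_one hDm
  have hDm' : D⁻¹ ^ orderOf g = 1 := by rw [inv_pow, hDm, inv_one]
  obtain ⟨k, hk⟩ := exists_pow_eq_self_of_coprime (n := Module.finrank ℂ V) (x := D⁻¹)
    ((hcop.coprime_dvd_left (finrank_dvd_card_of_isIrreducible ρ)).coprime_dvd_right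
      (orderOf_dvd_of_pow_eq_one hDm'))
  refine ⟨(D⁻¹ ^ k) • r • T, ?_, ?_, fun n => ?_⟩
  · rw [smul_pow, hrT, ← pow_mul, mul_comm, pow_mul, hDm', one_pow, one_smul]
  · rw [LinearMap.det_smul, ← hD, ← pow_mul, mul_comm k, pow_mul, hk, inv_mul_cancel₀ hD0]
  · simp only [smul_mul_assoc, mul_smul_comm, hT]

/-- A homomorphism on a normal subgroup `N` extends to `N⟨g⟩`, for `g` of order coprime to `|N|`,
by any compatible choice of the image of `g`. -/
theorem exists_extension_sup_zpowers {G M : Type*} [Group G] [Finite G] [Group M] (N : Subgroup G)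
    [N.Normal] {g : G} (hcop : (Nat.card N).Coprime (orderOf g)) (f : N →* M) (t : M)
    (ht : t ^ orderOf g = 1) (hconj : ∀ n, t * f n = f (MulAut.conjNormal g n) * t) :
    ∃ F : ↥(N ⊔ Subgroup.zpowers g) →* M,
      (∀ n, F (Subgroup.inclusion le_sup_left n) = f n) ∧
        F ⟨g, Subgroup.mem_sup_right (Subgroup.mem_zpowers g)⟩ = t := by
  let K := Subgroup.zpowers g
  let γ : K := ⟨g, Subgroup.mem_zpowers g⟩
  have hγ : ∀ k : K, k ∈ Subgroup.zpowers γ := by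
    rintro ⟨_, i, rfl⟩
    exact ⟨i, rfl⟩
  have horder : orderOf γ = orderOf g := Subgroup.orderOf_mk g _
  let τ : K →* M := monoidHomOfForallMemZpowers hγ (g' := t)
    (horder ▸ orderOf_dvd_of_pow_eq_one ht)
  have hτ : τ γ = t := monoidHomOfForallMemZpowers_apply_gen _ _
  let α : K →* MulAut N := MulAut.conjNormal.comp K.subtype
  let L := SemidirectProduct.lift (φ := α) f τ fun k => by
    obtain ⟨i, rfl⟩ := mem_powers_iff_mem_zpowers.2 (hγ k)
    ext n
    change f (α (γ ^ i) n) = τ (γ ^ i) * f n * (τ (γ ^ i))⁻¹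
    rw [map_pow, map_pow, hτ]
    change f ((MulAut.conjNormal g ^ i) n) = _
    induction i with
    | zero => simp
    | succ i ih =>
      rw [pow_succ', pow_succ', MulAut.mul_apply, mul_inv_rev, ← mul_inv_cancel_right (f _) t,
        ← hconj, ih]
      simp only [mul_assoc]
  let P : N ⋊[α] K →* ↥(N ⊔ K) := SemidirectProduct.lift (Subgroup.inclusion le_sup_left)
    (Subgroup.inclusion le_sup_right) fun k => by
      ext n
      simp [α]
  have hPval : ∀ x, (P x : G) = x.left * x.right := fun x => rfl
  have hP : Function.Bijective P := by
    refine ⟨(injective_iff_map_eq_one P).2 fun x hx => ?_, fun ⟨y, hy⟩ => ?_⟩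
    · have h1 : (x.left : G) * x.right = 1 := (hPval x).symm.trans (congrArg Subtype.val hx)
      have hdisj : Disjoint N K := Subgroup.disjoint_of_coprime_natCard
        (by rwa [Nat.card_zpowers])
      have hl := Subgroup.disjoint_def.1 hdisj x.left.2
        (eq_inv_of_mul_eq_one_left h1 ▸ K.inv_mem x.right.2)
      rw [hl, one_mul] at h1
      exact SemidirectProduct.ext (Subtype.ext hl) (Subtype.ext h1)
    · obtain ⟨n, hn, k, hk, rfl⟩ := Subgroup.mem_sup_of_normal_left.1 hy
      exact ⟨⟨⟨n, hn⟩, ⟨k, hk⟩⟩, rfl⟩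
  let Q := MulEquiv.ofBijective P hP
  refine ⟨L.comp Q.symm.toMonoidHom, fun n => ?_, ?_⟩
  · have : Q (SemidirectProduct.inl n) = Subgroup.inclusion le_sup_left n := by simp [Q, P]
    simp [← this, L]
  · have : Q (SemidirectProduct.inr γ) = ⟨g, Subgroup.mem_sup_right (Subgroup.mem_zpowers g)⟩ := by
      simp only [Q, P, MulEquiv.ofBijective_apply, SemidirectProduct.lift_inr]
      rfl
    simp [← this, L, hτ]

theorem IsPiNumber.piPart_eq_one {π : Set ℕ} {n : ℕ} (h : IsPiNumber πᶜ n) :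
    Nat.piPart π n = 1 :=
  Finset.prod_eq_one fun p hp =>
    if_neg (h p (Nat.prime_of_mem_primeFactors hp) (Nat.dvd_of_mem_primeFactors hp))

theorem elemPiPart_eq_one {π : Set ℕ} {G : Type} [Group G] {g : G}
    (hg : IsPiNumber πᶜ (orderOf g)) : elemPiPart π g = 1 := by
  rw [elemPiPart, hg.piPart_eq_one, Nat.totient_one, pow_one, Nat.div_one, pow_orderOf_eq_one]

theorem IsPiNumber.coprime {π : Set ℕ} {m n : ℕ} (hm : IsPiNumber π m) (hn : IsPiNumber πᶜ n) :
    m.Coprime n :=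
  Nat.coprime_of_dvd fun p hp h1 h2 => hn p hp h2 (hm p hp h1)

theorem isIrreducible_of_charInner {G : Type} [Group G] [Finite G] (W : FDRep ℂ G)
    (h : charInner G W.character W.character = 1) :
    Representation.IsIrreducible W.ρ := by
  have := Fintype.ofFinite G
  refine isIrreducible_of_sum_character_mul_inv W.ρ ?_
  rw [← h, charInner, finsum_eq_sum_of_fintype]
  congr 1
  refine Finset.sum_congr rfl fun g _ => ?_
  rw [character_inv_eq_conj _ (isOfFinOrder_of_finite g)]
  rfl

/-- A `G`-invariant irreducible character of `N` has a canonical extension to `N⟨g⟩` that does not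
vanish at `g`, for `g` of order coprime to `|N|`. -/
theorem exists_isCanonicalExtension_apply_ne_zero {G : Type} [Group G] [Finite G] (N : Subgroup G)
    [N.Normal] (θ : ↥N → ℂ) (hθ : IsIrrChar ↥N θ) (hinv : IsGInvariant N θ) (g : G)
    (hcop : (Nat.card N).Coprime (orderOf g)) :
    ∃ φ : ↥(N ⊔ Subgroup.zpowers g) → ℂ, IsCanonicalExtension le_sup_left θ φ ∧
      φ ⟨g, Subgroup.mem_sup_right (Subgroup.mem_zpowers g)⟩ ≠ 0 := by
  obtain ⟨⟨W, hW⟩, hnorm⟩ := hθ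
  obtain rfl : θ = W.character := funext hW
  have := isIrreducible_of_charInner W hnorm
  obtain ⟨T, hTm, hdet, hconj⟩ := exists_conj_intertwining N W.ρ hcop fun n => hinv g n
  let t : (Module.End ℂ W)ˣ := Units.ofPowEqOne T (orderOf g) hTm (orderOf_pos g).ne'
  obtain ⟨F, hFN, hFg⟩ := exists_extension_sup_zpowers N hcop W.ρ.toHomUnits t
    (Units.ext hTm) fun n => Units.ext (hconj n)
  let σ : Representation ℂ ↥(N ⊔ Subgroup.zpowers g) W := (Units.coeHom _).comp F
  have hσN : ∀ n : N, σ (Subgroup.inclusion le_sup_left n) = W.ρ n := fun n =>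
    congrArg Units.val (hFN n)
  have hσg : σ ⟨g, Subgroup.mem_sup_right (Subgroup.mem_zpowers g)⟩ = T := congrArg Units.val hFg
  let V := FDRep.of σ
  have hdetσ : ∀ h, ∃ n, LinearMap.det (σ h) = LinearMap.det (W.ρ n) := by
    rintro ⟨h, hh⟩
    obtain ⟨n, hn, _, ⟨i, rfl⟩, rfl⟩ := Subgroup.mem_sup_of_normal_left.1 hh
    refine ⟨⟨n, hn⟩, ?_⟩
    have hx : σ ⟨_, hh⟩ = W.ρ ⟨n, hn⟩ * (t ^ i : (Module.End ℂ W)ˣ) := by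
      rw [← hσN, ← hFg, ← map_zpow]
      exact map_mul σ (Subgroup.inclusion le_sup_left ⟨n, hn⟩)
        (⟨g, Subgroup.mem_sup_right (Subgroup.mem_zpowers g)⟩ ^ i)
    have hti : Units.map (LinearMap.det : Module.End ℂ W →* ℂ) (t ^ i) = 1 := by
      rw [map_zpow, show Units.map (LinearMap.det : Module.End ℂ W →* ℂ) t = 1 from Units.ext hdet,
        one_zpow]
    rw [hx, map_mul, show LinearMap.det ((t ^ i : (Module.End ℂ W)ˣ) : Module.End ℂ W) = 1 from
      congrArg Units.val hti, mul_one]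
  refine ⟨V.character, ⟨fun n => congrArg (LinearMap.trace ℂ W) (hσN n), V, W, fun _ => rfl,
    fun _ => rfl, ?_⟩, ?_⟩
  · refine congrArg sInf (Set.ext fun m => and_congr_right fun _ => ⟨fun H n => ?_, fun H h => ?_⟩)
    · rw [← hσN]
      exact H _
    · obtain ⟨n, hn⟩ := hdetσ h
      exact (congrArg (· ^ m) hn).trans (H n)
  · change LinearMap.trace ℂ W (σ _) ≠ 0
    rw [hσg]
    exact trace_ne_zero_of_conj_intertwining N W.ρ hcop T hTm hconj

theorem theta_hat_nonzero_on_pi_prime_elements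
    {G : Type} [Group G] [Finite G] (π : Set ℕ) (N : Subgroup G) [N.Normal]
    (hNpi : IsPiNumber π (Nat.card ↥N))
    (θ : ↥N → ℂ) (hθ : IsIrrChar ↥N θ) (hinv : IsGInvariant N θ)
    (θhat : G → ℂ)
    (hdef : ∀ (g : G), elemPiPart π g ∈ N →
      ∀ φ : ↥(N ⊔ Subgroup.zpowers g) → ℂ,
        IsCanonicalExtension le_sup_left θ φ →
        θhat g = φ ⟨g, Subgroup.mem_sup_right (Subgroup.mem_zpowers g)⟩)
    (hzero : ∀ g : G, elemPiPart π g ∉ N → θhat g = 0)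
    (g : G) (hg : IsPiNumber πᶜ (orderOf g)) :
    θhat g ≠ 0 := by
  obtain ⟨φ, hφ, hne⟩ :=
    exists_isCanonicalExtension_apply_ne_zero N θ hθ hinv g (hNpi.coprime hg)
  rw [hdef g (elemPiPart_eq_one hg ▸ N.one_mem) φ hφ]
  exact hne
end
end
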